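/- arXiv:0909.4561 — 4 statements merged into one kernel-verified Lean document; each statement's English description precedes it below -/
import Mathlib

section
/- Let X be a topological space homeomorphic to a closed subspace of some Euclidean space ℝ^ℓ. Then X has a finite basic family; that is, there exist finitely many continuous functions φ_1,…,φ_r : X → ℝ such that every continuous f : X → ℝ can be written f = Σ_{q=1}^{r} g_q ∘ φ_q for some continuous g_1,…,g_r : ℝ → ℝ. -/
namespace KS

open Set Filter Topology BoundedContinuousFunction

/-- continuous staircase: equals the floor where the fractional part is at most `1 - 1/m`. -/
noncomputable def stair (m : ℝ) (s : ℝ) : ℝ :=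
  s + (max 0 (m * Int.fract s - (m - 1)) - Int.fract s)

lemma stair_continuous {m : ℝ} (hm : 1 ≤ m) : Continuous (stair m) := by
  have h : Continuous ((fun u : ℝ => max 0 (m * u - (m - 1)) - u) ∘ Int.fract) := by
    apply ContinuousOn.comp_fract''
    · exact Continuous.continuousOn (by fun_prop)
    · have : m * 0 - (m - 1) ≤ 0 := by linarith
      simp only [max_eq_left this]
      norm_num
  exact continuous_id.add h

lemma stair_eq {m : ℝ} {s : ℝ} (h : m * Int.fract s ≤ m - 1) : stair m s = ⌊s⌋ := by
  unfold stair
  rw [max_eq_left (by linarith)]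
  have := Int.floor_add_fract s
  linarith

lemma stair_near {m : ℝ} (hm : 1 ≤ m) (s : ℝ) : |stair m s - s| ≤ 1 := by
  unfold stair
  have h0 := Int.fract_nonneg s
  have h1 := Int.fract_lt_one s
  have : max 0 (m * Int.fract s - (m - 1)) ≤ 1 := by
    apply max_le (by norm_num); nlinarith
  have : 0 ≤ max 0 (m * Int.fract s - (m - 1)) := le_max_left _ _
  rw [abs_le]; constructor <;> linarith

/-- finite interpolation -/
lemma interp {Y : Type*} [TopologicalSpace Y] [NormalSpace Y] [T1Space Y] (A : Set Y)
    (hA : A.Finite) (a : Y → ℝ) (ε : ℝ) (hε : 0 ≤ ε) (ha : ∀ y ∈ A, |a y| ≤ ε) :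
    ∃ w : C(Y, ℝ), (∀ y, |w y| ≤ ε) ∧ ∀ y ∈ A, w y = a y := by
  have hd : DiscreteTopology A := by
    have := hA.to_subtype
    infer_instance
  obtain ⟨g, hg, hgr⟩ := ContinuousMap.exists_restrict_eq_forall_mem_of_closed
    (s := A) ⟨fun y : A => a y, continuous_of_discreteTopology⟩ (t := Icc (-ε) ε)
    (fun x => abs_le.1 (ha x x.2)) ⟨0, by simpa using hε⟩ hA.isClosed
  refine ⟨g, fun y => abs_le.2 (hg y), fun y hy => ?_⟩
  have := congrArg (fun h : C(A, ℝ) => h ⟨y, hy⟩) hgr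
  simpa using this

lemma perturb {Y : Type*} (A : Set Y) (hA : A.Finite) (a : Y → ℝ) (ε : ℝ) (hε : 0 < ε) :
    ∃ y : Y → ℝ, InjOn y A ∧ ∀ i, |y i - a i| ≤ ε := by
  classical
  induction A, hA using Set.Finite.induction_on with
  | empty => exact ⟨a, by simp, by simp [hε.le]⟩
  | @insert i s his hs ih =>
    obtain ⟨y, hy, hya⟩ := ih
    have hinf : (Icc (a i - ε) (a i + ε) \ y '' s).Nonempty :=
      ((Icc_infinite (by linarith)).sdiff (hs.image y)).nonempty
    obtain ⟨v, hv, hvs⟩ := hinf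
    refine ⟨Function.update y i v, ?_, ?_⟩
    · have hne : ∀ b ∈ s, b ≠ i := fun b hb h => his (h ▸ hb)
      rw [injOn_insert his]
      constructor
      · intro b hb c hc h
        rw [Function.update_of_ne (hne b hb), Function.update_of_ne (hne c hc)] at h
        exact hy hb hc h
      · rintro ⟨b, hb, h⟩
        rw [Function.update_of_ne (hne b hb), Function.update_self] at h
        exact hvs ⟨b, hb, h⟩
    · intro j
      by_cases hj : j = i
      · subst hj
        rw [Function.update_self, abs_le]
        constructor <;> linarith [hv.1, hv.2]
      · rw [Function.update_of_ne hj]; exact hya j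

lemma one_dim (m : ℕ) (hm : 1 ≤ m) (δ : ℝ) (hδ : 0 < δ) :
    ∃ (p : Fin m → unitInterval → unitInterval) (good : Fin m → Set unitInterval),
      (∀ q, Continuous (p q)) ∧ (∀ q t, dist (p q t) t ≤ δ) ∧ (∀ q, (p q '' good q).Finite) ∧
      ∀ t q q', t ∉ good q → t ∉ good q' → q = q' := by
  obtain ⟨N, hN⟩ := exists_nat_gt (1 / δ)
  have hN0 : (0:ℝ) < N := lt_trans (by positivity) hN
  have hm' : (1:ℝ) ≤ m := by exact_mod_cast hm
  have hm0 : (0:ℝ) < m := by linarith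
  let s : Fin m → unitInterval → ℝ := fun q t => (t:ℝ) * N - ((q:ℕ) + 1) / m
  let pp : Fin m → unitInterval → ℝ := fun q t => (stair m (s q t) + ((q:ℕ) + 1) / m) / N
  refine ⟨fun q t => projIcc 0 1 zero_le_one (pp q t),
    fun q => {t | (m:ℝ) * Int.fract (s q t) ≤ m - 1}, ?_, ?_, ?_, ?_⟩
  · intro q
    refine continuous_projIcc.comp ?_
    refine Continuous.div_const (Continuous.add ((stair_continuous hm').comp ?_)
      continuous_const) _
    fun_prop
  · intro q t
    have h1 : projIcc (0:ℝ) 1 zero_le_one (t:ℝ) = t := projIcc_val _ _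
    have h2 := Set.abs_projIcc_sub_projIcc (a := (0:ℝ)) (b := 1) (c := pp q t) (d := t)
      zero_le_one
    rw [h1] at h2
    rw [Subtype.dist_eq, Real.dist_eq]
    refine h2.trans ?_
    have h3 : pp q t - t = (stair m (s q t) - s q t) / N := by
      simp only [pp, s]; field_simp; ring
    rw [h3, abs_div, abs_of_pos hN0, div_le_iff₀ hN0]
    refine (stair_near hm' _).trans ?_
    rw [div_lt_iff₀ hδ] at hN
    linarith
  · intro q
    have : ((fun k : ℤ => projIcc (0:ℝ) 1 zero_le_one (((k:ℝ) + ((q:ℕ) + 1) / m) / N)) ''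
      (Icc (-(((q:ℕ):ℤ) + 1)) N)).Finite := (Set.finite_Icc _ _).image _
    refine this.subset ?_
    rintro _ ⟨t, ht, rfl⟩
    refine ⟨⌊s q t⌋, ?_, ?_⟩
    · have t0 := t.2.1
      have t1 := t.2.2
      have hq : (((q:ℕ):ℝ) + 1) / m ≤ (q:ℕ) + 1 := div_le_self (by positivity) hm'
      have hq' : 0 ≤ (((q:ℕ):ℝ) + 1) / m := by positivity
      constructor
      · rw [Int.le_floor]; push_cast
        have : 0 ≤ (t:ℝ) * N := by positivity
        simp only [s]; linarith
      · have : s q t ≤ N := by simp only [s]; nlinarith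
        have := (Int.floor_le (s q t)).trans this
        exact_mod_cast this
    · simp only [pp]
      rw [stair_eq ht]
  · intro t q q' h h'
    simp only [mem_ofPred_eq, not_le] at h h'
    have e1 := Int.floor_add_fract (s q t)
    have e2 := Int.floor_add_fract (s q' t)
    have l1 := Int.fract_lt_one (s q t)
    have l2 := Int.fract_lt_one (s q' t)
    set u := Int.fract (s q t)
    set u' := Int.fract (s q' t)
    have e3 : (m:ℝ) * (u - u') = ((q':ℕ):ℝ) - (q:ℕ) - m * (⌊s q t⌋ - ⌊s q' t⌋ : ℤ) := by
      have a1 : u = (t:ℝ) * N - ((q:ℕ) + 1) / m - ⌊s q t⌋ := by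
        have : s q t = (t:ℝ) * N - ((q:ℕ) + 1) / m := rfl
        linarith
      have a2 : u' = (t:ℝ) * N - ((q':ℕ) + 1) / m - ⌊s q' t⌋ := by
        have : s q' t = (t:ℝ) * N - ((q':ℕ) + 1) / m := rfl
        linarith
      rw [a1, a2]; push_cast; field_simp; ring
    set d : ℤ := ⌊s q t⌋ - ⌊s q' t⌋
    have b1 : (m:ℝ) * (u - u') < 1 := by nlinarith
    have b2 : -1 < (m:ℝ) * (u - u') := by nlinarith
    rw [e3] at b1 b2
    have c1 : ((q':ℕ):ℤ) - (q:ℕ) - m * d < 1 := by exact_mod_cast b1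
    have c2 : -1 < ((q':ℕ):ℤ) - (q:ℕ) - m * d := by exact_mod_cast b2
    have c3 : ((q':ℕ):ℤ) - (q:ℕ) = m * d := by omega
    have hq := q.2
    have hq' := q'.2
    have hd : d = 0 := by
      by_contra hd
      rcases lt_or_gt_of_ne hd with h | h
      · have : (m:ℤ) * d ≤ m * (-1) := by
          apply mul_le_mul_of_nonneg_left <;> omega
        omega
      · have : (m:ℤ) * 1 ≤ m * d := by
          apply mul_le_mul_of_nonneg_left <;> omega
        omega
    rw [hd] at c3
    apply Fin.ext
    omega

lemma multi_dim (n m : ℕ) (hm : 1 ≤ m) (δ : ℝ) (hδ : 0 < δ) :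
    ∃ (p : Fin m → C(Fin n → unitInterval, Fin n → unitInterval))
      (good : Fin m → Set (Fin n → unitInterval)),
      (∀ q t, dist (p q t) t ≤ δ) ∧ (∀ q, (p q '' good q).Finite) ∧
      ∀ t, {q | t ∉ good q}.ncard ≤ n := by
  obtain ⟨p, good, hc, hd, hf, hu⟩ := one_dim m hm δ hδ
  refine ⟨fun q => ⟨fun x j => p q (x j), ?_⟩, fun q => {x | ∀ j, x j ∈ good q}, ?_, ?_, ?_⟩
  · exact continuous_pi fun j => (hc q).comp (continuous_apply j)
  · intro q t
    rw [dist_pi_le_iff hδ.le]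
    exact fun j => hd q _
  · intro q
    refine (Set.Finite.pi' (fun _ : Fin n => hf q)).subset ?_
    rintro _ ⟨x, hx, rfl⟩ j
    exact ⟨x j, hx j, rfl⟩
  · intro t
    have : {q | t ∉ {x : Fin n → unitInterval | ∀ j, x j ∈ good q}} ⊆
        ⋃ j : Fin n, {q | t j ∉ good q} := by
      intro q hq
      simp only [mem_ofPred_eq, not_forall] at hq
      simpa using hq
    refine (ncard_le_ncard this (toFinite _)).trans ?_
    have h2 : (⋃ j : Fin n, {q | t j ∉ good q}).ncard ≤ ∑ j : Fin n, {q | t j ∉ good q}.ncard := by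
      exact ncard_iUnion_le_of_fintype fun i => {q | t i ∉ good q}
    refine h2.trans ?_
    have : ∀ j : Fin n, {q | t j ∉ good q}.ncard ≤ 1 := fun j => by
      rw [ncard_le_one]
      exact fun a ha b hb => hu (t j) a b ha hb
    calc _ ≤ ∑ j : Fin n, 1 := Finset.sum_le_sum fun j _ => this j
      _ = n := by simp


lemma dens (n : ℕ) (φ0 : Fin (4 * n + 4) → C(Fin n → unitInterval, ℝ)) (ε : ℝ) (hε : 0 < ε)
    (f : C(Fin n → unitInterval, ℝ)) (hf : f ≠ 0) :
    ∃ φ : Fin (4 * n + 4) → C(Fin n → unitInterval, ℝ), (∀ q, ‖φ q - φ0 q‖ ≤ ε) ∧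
      ∃ g : Fin (4 * n + 4) → (ℝ →ᵇ ℝ), (∀ q, ‖g q‖ ≤ ‖f‖) ∧
        ‖f - ∑ q, (g q).toContinuousMap.comp (φ q)‖ < 3 / 4 * ‖f‖ := by
  have hF : 0 < ‖f‖ := norm_pos_iff.2 hf
  have huc : UniformContinuous
      (fun x : Fin n → unitInterval => ((f x, fun q => φ0 q x) : ℝ × (Fin (4 * n + 4) → ℝ))) := by
    apply CompactSpace.uniformContinuous_of_continuous
    fun_prop
  obtain ⟨δ, hδ, hδ'⟩ := Metric.uniformContinuous_iff.1 huc (min (‖f‖ / 8) (ε / 2)) (by positivity)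
  obtain ⟨p, good, hd, hfin, hcard⟩ := multi_dim n (4 * n + 4) (by omega) (δ / 2) (by positivity)
  have hclose : ∀ q x, |f (p q x) - f x| ≤ ‖f‖ / 8 ∧ |φ0 q (p q x) - φ0 q x| ≤ ε / 2 := by
    intro q x
    have h := hδ' (lt_of_le_of_lt (hd q x) (by linarith))
    rw [Prod.dist_eq, max_lt_iff] at h
    constructor
    · rw [← Real.dist_eq]
      exact (h.1.trans_le (min_le_left _ _)).le
    · rw [← Real.dist_eq]
      exact ((dist_le_pi_dist _ _ q).trans_lt (h.2.trans_le (min_le_right _ _))).le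
  have hw : ∀ q, ∃ w : C(Fin n → unitInterval, ℝ), (∀ y, |w y| ≤ ε / 2) ∧
      InjOn (fun y => φ0 q y + w y) (p q '' good q) := by
    intro q
    obtain ⟨y, hy, hya⟩ := perturb (p q '' good q) (hfin q) (φ0 q) (ε / 2) (by positivity)
    obtain ⟨w, hw, hwa⟩ := interp (p q '' good q) (hfin q) (fun z => y z - φ0 q z) (ε / 2)
      (by positivity) (fun z _ => hya z)
    refine ⟨w, hw, hy.congr ?_⟩
    intro z hz
    simp only [hwa z hz]; ring
  choose w hwb hwi using hw
  have hg : ∀ q, ∃ g : C(ℝ, ℝ), (∀ y, |g y| ≤ ‖f‖ / ((4 * n + 4 : ℕ) : ℝ)) ∧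
      ∀ x ∈ good q, g (φ0 q (p q x) + w q (p q x)) = f (p q x) / ((4 * n + 4 : ℕ) : ℝ) := by
    intro q
    obtain ⟨g, hg, hga⟩ := interp ((fun y => φ0 q y + w q y) '' (p q '' good q)) ((hfin q).image _)
      (fun v => f (Function.invFunOn (fun y => φ0 q y + w q y) (p q '' good q) v)
        / ((4 * n + 4 : ℕ) : ℝ))
      (‖f‖ / ((4 * n + 4 : ℕ) : ℝ)) (by positivity) (by
        intro v _
        rw [abs_div, abs_of_nonneg (Nat.cast_nonneg (4 * n + 4) : (0:ℝ) ≤ _)]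
        gcongr
        exact f.norm_coe_le_norm _)
    refine ⟨g, hg, fun x hx => ?_⟩
    have hmem : p q x ∈ p q '' good q := ⟨x, hx, rfl⟩
    rw [hga _ ⟨p q x, hmem, rfl⟩]
    have := (hwi q).leftInvOn_invFunOn hmem
    rw [this]
  choose g hgb hgv using hg
  have hm0 : (0:ℝ) < ((4 * n + 4 : ℕ) : ℝ) := by positivity
  have hm1 : (1:ℝ) ≤ ((4 * n + 4 : ℕ) : ℝ) := by push_cast; linarith [(Nat.cast_nonneg n : (0:ℝ) ≤ n)]
  refine ⟨fun q => (φ0 q + w q).comp (p q), ?_,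
    fun q => BoundedContinuousFunction.ofNormedAddCommGroup (g q) (g q).continuous
      (‖f‖ / ((4 * n + 4 : ℕ) : ℝ)) (hgb q), ?_, ?_⟩
  · intro q
    rw [ContinuousMap.norm_le _ hε.le]
    intro x
    have h1 := (hclose q x).2
    have h2 := hwb q (p q x)
    simp only [ContinuousMap.sub_apply, ContinuousMap.comp_apply, ContinuousMap.add_apply,
      Real.norm_eq_abs]
    rw [abs_le] at *
    constructor <;> linarith [h1.1, h1.2, h2.1, h2.2]
  · intro q
    rw [BoundedContinuousFunction.norm_le hF.le]
    intro y
    exact (hgb q y).trans (div_le_self hF.le hm1)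
  · refine lt_of_le_of_lt ?_ (show 5 / 8 * ‖f‖ < 3 / 4 * ‖f‖ by linarith)
    rw [ContinuousMap.norm_le _ (by positivity)]
    intro x
    classical
    have key : ∀ q, |f x / ((4 * n + 4 : ℕ) : ℝ) - g q (φ0 q (p q x) + w q (p q x))| ≤
        ‖f‖ / 8 / ((4 * n + 4 : ℕ) : ℝ) +
          if x ∉ good q then 2 * ‖f‖ / ((4 * n + 4 : ℕ) : ℝ) else 0 := by
      intro q
      by_cases hx : x ∈ good q
      · rw [hgv q x hx, ← sub_div, abs_div, abs_of_pos hm0, abs_sub_comm]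
        simp only [hx, not_true_eq_false, if_false, add_zero]
        gcongr
        exact (hclose q x).1
      · simp only [hx, not_false_eq_true, if_true]
        refine (abs_sub _ _).trans ?_
        rw [abs_div, abs_of_pos hm0]
        have h1 : |f x| ≤ ‖f‖ := f.norm_coe_le_norm x
        have h2 := hgb q (φ0 q (p q x) + w q (p q x))
        have h3 : |f x| / ((4 * n + 4 : ℕ) : ℝ) ≤ ‖f‖ / ((4 * n + 4 : ℕ) : ℝ) := by gcongr
        have h4 : 0 ≤ ‖f‖ / 8 / ((4 * n + 4 : ℕ) : ℝ) := by positivity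
        have h5 : 2 * ‖f‖ / ((4 * n + 4 : ℕ) : ℝ) =
          ‖f‖ / ((4 * n + 4 : ℕ) : ℝ) + ‖f‖ / ((4 * n + 4 : ℕ) : ℝ) := by ring
        linarith
    have e : f x = ∑ q : Fin (4 * n + 4), f x / ((4 * n + 4 : ℕ) : ℝ) := by
      rw [Finset.sum_const, Finset.card_univ, Fintype.card_fin, nsmul_eq_mul]
      field_simp
    have e2 : (f - ∑ q, ((BoundedContinuousFunction.ofNormedAddCommGroup (g q) (g q).continuous
      (‖f‖ / ((4 * n + 4 : ℕ) : ℝ)) (hgb q)).toContinuousMap).comp ((φ0 q + w q).comp (p q))) x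
      = ∑ q, (f x / ((4 * n + 4 : ℕ) : ℝ) - g q (φ0 q (p q x) + w q (p q x))) := by
      rw [Finset.sum_sub_distrib, ← e, ContinuousMap.sub_apply, ContinuousMap.sum_apply]
      rfl
    rw [e2, Real.norm_eq_abs]
    refine (Finset.abs_sum_le_sum_abs _ _).trans ((Finset.sum_le_sum fun q _ => key q).trans ?_)
    rw [Finset.sum_add_distrib, Finset.sum_const, ← Finset.sum_filter, Finset.sum_const,
      Finset.card_univ, Fintype.card_fin, nsmul_eq_mul, nsmul_eq_mul]
    have hc : ((Finset.univ.filter fun q => x ∉ good q).card : ℝ) ≤ n := by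
      have := hcard x
      rw [Set.ncard_eq_toFinset_card'] at this
      have h' : {q | x ∉ good q}.toFinset = Finset.univ.filter fun q => x ∉ good q := by
        ext; simp
      rw [h'] at this
      exact_mod_cast this
    have h1 : ((4 * n + 4 : ℕ) : ℝ) * (‖f‖ / 8 / ((4 * n + 4 : ℕ) : ℝ)) = ‖f‖ / 8 := by
      field_simp
    have h2 : ((Finset.univ.filter fun q => x ∉ good q).card : ℝ) *
        (2 * ‖f‖ / ((4 * n + 4 : ℕ) : ℝ)) ≤ ‖f‖ / 2 := by
      rw [← mul_div_assoc, div_le_iff₀ hm0]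
      push_cast
      nlinarith
    linarith

lemma core (n : ℕ) : ∃ φ : Fin (4 * n + 4) → C(Fin n → unitInterval, ℝ),
    ∀ f : C(Fin n → unitInterval, ℝ), ∃ g : Fin (4 * n + 4) → (ℝ →ᵇ ℝ),
      (∀ q, ‖g q‖ ≤ 2 * ‖f‖) ∧
        ‖f - ∑ q, (g q).toContinuousMap.comp (φ q)‖ ≤ 9 / 10 * ‖f‖ := by
  obtain ⟨D, hDc, hDd⟩ := TopologicalSpace.exists_countable_dense C(Fin n → unitInterval, ℝ)
  let Ω : C(Fin n → unitInterval, ℝ) → Set (Fin (4 * n + 4) → C(Fin n → unitInterval, ℝ)) :=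
    fun f => {φ | ∃ g : Fin (4 * n + 4) → (ℝ →ᵇ ℝ), (∀ q, ‖g q‖ ≤ ‖f‖) ∧
        ‖f - ∑ q, (g q).toContinuousMap.comp (φ q)‖ < 3 / 4 * ‖f‖}
  have hopen : ∀ f ∈ D \ {0}, IsOpen (Ω f) := by
    intro f _
    have : Ω f = ⋃ g ∈ {g : Fin (4 * n + 4) → (ℝ →ᵇ ℝ) | ∀ q, ‖g q‖ ≤ ‖f‖},
        {φ | ‖f - ∑ q, (g q).toContinuousMap.comp (φ q)‖ < 3 / 4 * ‖f‖} := by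
      ext φ; simp [Ω]
    rw [this]
    refine isOpen_biUnion fun g _ => ?_
    refine isOpen_lt ?_ continuous_const
    refine continuous_norm.comp (continuous_const.sub (continuous_finsetSum _ fun q _ => ?_))
    exact (ContinuousMap.continuous_postcomp _).comp (continuous_apply q)
  have hdense : ∀ f ∈ D \ {0}, Dense (Ω f) := by
    intro f hf
    rw [Metric.dense_iff]
    intro φ0 r hr
    obtain ⟨φ, h1, h2⟩ := dens n φ0 (r / 2) (by positivity) f hf.2
    refine ⟨φ, ?_, h2⟩
    rw [Metric.mem_ball]
    refine lt_of_le_of_lt ((dist_pi_le_iff (by positivity)).2 fun q => ?_) (half_lt_self hr)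
    rw [dist_eq_norm]; exact h1 q
  obtain ⟨φ, hφ⟩ := (dense_biInter_of_isOpen hopen (hDc.mono sdiff_subset) hdense).nonempty
  refine ⟨φ, fun f => ?_⟩
  by_cases hf : f = 0
  · subst hf
    refine ⟨0, by simp, ?_⟩
    have : (0 : C(Fin n → unitInterval, ℝ)) - ∑ q, ((0 : Fin (4 * n + 4) → (ℝ →ᵇ ℝ)) q).toContinuousMap.comp (φ q) = 0 := by
      ext x; simp
    rw [this]; simp
  have hF : 0 < ‖f‖ := norm_pos_iff.2 hf
  obtain ⟨d, hd, hdD⟩ := Metric.dense_iff.1 hDd f (‖f‖ / 100) (by positivity)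
  rw [Metric.mem_ball, dist_eq_norm] at hd
  have hd1 : ‖d‖ ≤ ‖f‖ + ‖f‖ / 100 := by
    have := norm_add_le f (d - f)
    rw [add_sub_cancel] at this
    linarith
  have hd0 : d ≠ 0 := by
    rintro rfl
    rw [zero_sub, norm_neg] at hd
    linarith
  obtain ⟨g, hg, hgd⟩ : φ ∈ Ω d := by
    simp only [mem_iInter] at hφ
    exact hφ d ⟨hdD, hd0⟩
  refine ⟨g, fun q => (hg q).trans (by linarith), ?_⟩
  have h3 := norm_add_le (f - d) (d - ∑ q, (g q).toContinuousMap.comp (φ q))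
  rw [sub_add_sub_cancel, norm_sub_rev f d] at h3
  linarith

lemma cube (n : ℕ) : ∃ φ : Fin (4 * n + 4) → C(Fin n → unitInterval, ℝ),
    ∀ f : C(Fin n → unitInterval, ℝ), ∃ g : Fin (4 * n + 4) → C(ℝ, ℝ),
      ∀ x, f x = ∑ q, g q (φ q x) := by
  obtain ⟨φ, hφ⟩ := core n
  refine ⟨φ, fun f => ?_⟩
  choose G hG hGr using hφ
  let F : ℕ → C(Fin n → unitInterval, ℝ) := fun k =>
    (fun h => h - ∑ q, (G h q).toContinuousMap.comp (φ q))^[k] f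
  have hF1 : ∀ k, F (k + 1) = F k - ∑ q, (G (F k) q).toContinuousMap.comp (φ q) := fun k => by
    simp only [F, Function.iterate_succ_apply']
  have hFn : ∀ k, ‖F k‖ ≤ (9 / 10) ^ k * ‖f‖ := by
    intro k
    induction k with
    | zero => simp [F]
    | succ k ih =>
      rw [hF1, pow_succ]
      refine (hGr _).trans ?_
      linarith
  have hgeo : Summable fun k : ℕ => 2 * ((9 / 10 : ℝ) ^ k * ‖f‖) :=
    ((summable_geometric_of_lt_one (by norm_num) (by norm_num)).mul_right _).mul_left _
  have hsum : ∀ q, Summable fun k => G (F k) q := fun q =>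
    Summable.of_norm_bounded hgeo fun k => (hG (F k) q).trans (by linarith [hFn k])
  refine ⟨fun q => (∑' k, G (F k) q).toContinuousMap, fun x => ?_⟩
  have h1 : HasSum (fun k => ∑ q, G (F k) q (φ q x)) (∑ q, (∑' k, G (F k) q) (φ q x)) := by
    refine hasSum_sum fun q _ => ?_
    exact (BoundedContinuousFunction.evalCLM ℝ (φ q x)).hasSum (hsum q).hasSum
  have h2 : ∀ N, ∑ k ∈ Finset.range N, ∑ q, G (F k) q (φ q x) = f x - F N x := by
    intro N
    induction N with
    | zero => simp [F]
    | succ N ih =>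
      rw [Finset.sum_range_succ, ih, hF1, ContinuousMap.sub_apply, ContinuousMap.sum_apply]
      simp only [ContinuousMap.comp_apply, BoundedContinuousFunction.coe_toContinuousMap]
      ring
  have h3 : Tendsto (fun N => F N x) atTop (𝓝 0) := by
    refine squeeze_zero_norm (a := fun k => (9 / 10 : ℝ) ^ k * ‖f‖)
      (fun k => ((F k).norm_coe_le_norm x).trans (hFn k)) ?_
    simpa using (tendsto_pow_atTop_nhds_zero_of_lt_one (by norm_num : (0:ℝ) ≤ 9 / 10)
      (by norm_num)).mul_const ‖f‖
  have h4 := h1.tendsto_sum_nat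
  simp only [h2] at h4
  have h5 := h3.const_sub (f x)
  rw [sub_zero] at h5
  exact tendsto_nhds_unique h5 h4

lemma sigmoid : ∃ σ : ℝ → ℝ, Continuous σ ∧ (∀ x, σ x ∈ Icc (0:ℝ) 1) ∧
    ∀ R : ℝ, 0 ≤ R → ∃ ρ : ℝ → ℝ, Continuous ρ ∧ (∀ y, |ρ y| ≤ R) ∧
      ∀ x, |x| ≤ R → ρ (σ x) = x := by
  have hp : ∀ x : ℝ, 0 < 1 + |x| := fun x => by positivity
  refine ⟨fun x => (1 + x / (1 + |x|)) / 2, ?_, ?_, ?_⟩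
  · refine Continuous.div_const (continuous_const.add (continuous_id.div (by fun_prop)
      fun x => (hp x).ne')) _
  · intro x
    have h1 : x / (1 + |x|) ≤ 1 := by
      rw [div_le_one (hp x)]; linarith [le_abs_self x]
    have h2 : -1 ≤ x / (1 + |x|) := by
      rw [le_div_iff₀ (hp x)]; linarith [neg_abs_le x]
    constructor <;> linarith
  · intro R hR
    have hR1 : 0 < 1 / (R + 1) := by positivity
    refine ⟨fun y => max (-R) (min R ((2 * y - 1) / max (1 - |2 * y - 1|) (1 / (R + 1)))), ?_, ?_, ?_⟩
    · refine continuous_const.max (continuous_const.min (Continuous.div (by fun_prop)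
        (by fun_prop) fun y => ?_))
      exact (lt_of_lt_of_le hR1 (le_max_right _ _)).ne'
    · intro y
      rw [abs_le]
      exact ⟨le_max_left _ _, max_le (by linarith) (min_le_left _ _)⟩
    · intro x hx
      have e1 : 2 * ((1 + x / (1 + |x|)) / 2) - 1 = x / (1 + |x|) := by ring
      have e2 : 1 - |x / (1 + |x|)| = 1 / (1 + |x|) := by
        rw [abs_div, abs_of_pos (hp x)]
        have := (hp x).ne'
        field_simp
        ring
      have e3 : 1 / (R + 1) ≤ 1 / (1 + |x|) :=
        one_div_le_one_div_of_le (hp x) (by linarith)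
      simp only [e1, e2, max_eq_left e3]
      have e4 : x / (1 + |x|) / (1 / (1 + |x|)) = x := by
        have := (hp x).ne'
        field_simp
      rw [e4, min_eq_right (abs_le.1 hx).2, max_eq_right (abs_le.1 hx).1]

/-- a function on `ℝ × ℝ^ℓ` which is `a * b (w / a)` with `b` bounded is continuous. -/
lemma cone_cont {Z : Type*} [TopologicalSpace Z] {ℓ : ℕ} (b : (Fin ℓ → ℝ) → ℝ) (hb : Continuous b)
    (M : ℝ) (hM : ∀ y, |b y| ≤ M) (a : Z → ℝ) (ha : Continuous a) (w : Z → Fin ℓ → ℝ)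
    (hw : Continuous w) : Continuous fun z => a z * b (fun j => w z j / a z) := by
  rw [continuous_iff_continuousAt]
  intro z
  by_cases h : a z = 0
  · have h1 : Tendsto (fun z' => M * |a z'|) (𝓝 z) (𝓝 0) := by
      have := (by fun_prop : Continuous fun z' => M * |a z'|).tendsto z
      simpa [h] using this
    unfold ContinuousAt
    have h0 : (fun z => a z * b (fun j => w z j / a z)) z = 0 := by simp [h]
    rw [h0]
    refine squeeze_zero_norm (fun z' => ?_) h1
    rw [Real.norm_eq_abs, abs_mul, mul_comm]
    gcongr
    exact hM _
  · refine ha.continuousAt.mul (hb.continuousAt.comp ?_)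
    refine continuousAt_pi.2 fun j => ?_
    exact ((continuous_apply j).comp hw).continuousAt.div ha.continuousAt h

/-- gluing translates -/
lemma glue (R : ℝ) (hR : 0 ≤ R) (g : ℤ → C(ℝ, ℝ)) : ∃ G : ℝ → ℝ, Continuous G ∧
    ∀ (i : ℤ) (y : ℝ), |y| ≤ R → G (y + (2 * R + 2) * i) = g i y := by
  let L : ℝ := 2 * R + 2
  have hL : 0 < L := by positivity
  let β : ℝ → ℝ := fun s => max 0 (min 1 (R + 1 - |s|))
  have hβ : Continuous β := by fun_prop
  have hβ0 : ∀ s, R + 1 ≤ |s| → β s = 0 := fun s hs => by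
    have : min 1 (R + 1 - |s|) ≤ 0 := (min_le_right _ _).trans (by linarith)
    exact max_eq_left this
  have hβ1 : ∀ s, |s| ≤ R → β s = 1 := fun s hs => by
    have : min 1 (R + 1 - |s|) = 1 := min_eq_left (by linarith)
    simp [β, this]
  refine ⟨fun y => ∑ᶠ i : ℤ, β (y - L * i) * g i (y - L * i), ?_, ?_⟩
  · apply continuous_finsum
    · intro i
      fun_prop
    · intro y
      refine ⟨Metric.ball y 1, Metric.ball_mem_nhds _ one_pos, ?_⟩
      refine (Set.finite_Icc ⌊(y - R - 2) / L⌋ ⌈(y + R + 2) / L⌉).subset ?_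
      rintro i ⟨z, hz, hzb⟩
      have hz' : |z - L * i| < R + 1 := by
        by_contra hcon
        push Not at hcon
        apply hz
        simp [hβ0 _ hcon]
      rw [Metric.mem_ball, Real.dist_eq] at hzb
      rw [abs_lt] at hz' hzb
      constructor
      · have : (y - R - 2) / L ≤ i := by
          rw [div_le_iff₀ hL]; linarith
        exact_mod_cast (Int.floor_le _).trans this
      · have : (i:ℝ) ≤ (y + R + 2) / L := by
          rw [le_div_iff₀ hL]; linarith
        exact_mod_cast this.trans (Int.le_ceil _)
  · intro i y hy
    change ∑ᶠ j : ℤ, β (y + L * i - L * j) * g j (y + L * i - L * j) = g i y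
    rw [finsum_eq_single _ i]
    · simp [hβ1 y hy]
    · intro j hj
      rw [hβ0, zero_mul]
      have h1 : (1:ℝ) ≤ |(i:ℝ) - j| := by
        have : 1 ≤ |i - j| := Int.one_le_abs (sub_ne_zero.2 (Ne.symm hj))
        exact_mod_cast this
      have h2 : L ≤ |L * ((i:ℝ) - j)| := by
        rw [abs_mul, abs_of_pos hL]; nlinarith
      have h3 : L * ((i:ℝ) - j) = (y + L * i - L * j) - y := by ring
      rw [h3] at h2
      have h4 := abs_sub (y + L * i - L * j) y
      have : L = 2 * R + 2 := rfl
      linarith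

/-- bump in the radial variable -/
noncomputable def bump (s : ℝ) : ℝ := max 0 (Int.fract s * (3 / 4 - Int.fract s))

lemma bump_continuous : Continuous bump := by
  have h : Continuous ((fun u : ℝ => max 0 (u * (3 / 4 - u))) ∘ Int.fract) := by
    apply ContinuousOn.comp_fract''
    · exact Continuous.continuousOn (by fun_prop)
    · norm_num
  exact h

lemma bump_nonneg (s : ℝ) : 0 ≤ bump s := le_max_left _ _

lemma bump_le (s : ℝ) : bump s ≤ 1 := by
  have h0 := Int.fract_nonneg s
  have h1 := Int.fract_lt_one s
  apply max_le (by norm_num)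
  nlinarith

lemma bump_pos {s : ℝ} (h : 0 < Int.fract s) (h' : Int.fract s < 3 / 4) : 0 < bump s :=
  lt_max_of_lt_right (mul_pos h (by linarith))

lemma stair_of_bump {s : ℝ} (h : bump s ≠ 0) : stair 4 s = ⌊s⌋ := by
  apply stair_eq
  by_contra hcon
  push Not at hcon
  apply h
  have h0 := Int.fract_nonneg s
  apply max_eq_left
  nlinarith

lemma bump_add_pos (s : ℝ) : 0 < bump (s + 0) + bump (s + 1 / 2) := by
  rw [add_zero]
  have h0 := Int.fract_nonneg s
  have h1 := Int.fract_lt_one s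
  have e := Int.floor_add_fract s
  have b0 := bump_nonneg s
  have b1 := bump_nonneg (s + 1 / 2)
  by_cases h : 0 < Int.fract s ∧ Int.fract s < 3 / 4
  · linarith [bump_pos h.1 h.2]
  · suffices 0 < bump (s + 1 / 2) by linarith
    rcases h0.eq_or_lt with h2 | h2
    · have : Int.fract (s + 1 / 2) = 1 / 2 := by
        rw [Int.fract_eq_iff]
        refine ⟨by norm_num, by norm_num, ⌊s⌋, ?_⟩
        linarith
      apply bump_pos <;> rw [this] <;> norm_num
    · have h3 : 3 / 4 ≤ Int.fract s := by
        by_contra hc; exact h ⟨h2, not_le.1 hc⟩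
      have : Int.fract (s + 1 / 2) = Int.fract s - 1 / 2 := by
        rw [Int.fract_eq_iff]
        refine ⟨by linarith, by linarith, ⌊s⌋ + 1, ?_⟩
        push_cast; linarith
      apply bump_pos <;> rw [this] <;> linarith

lemma colour (ℓ : ℕ) (c : ℝ) : ∃ φ : Option (Fin (4 * (ℓ + 1) + 4)) → (Fin ℓ → ℝ) → ℝ,
    (∀ q, Continuous (φ q)) ∧ ∀ B : (Fin ℓ → ℝ) → ℝ, Continuous B →
      ∃ g : Option (Fin (4 * (ℓ + 1) + 4)) → ℝ → ℝ, (∀ q, Continuous (g q)) ∧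
        ∀ x, bump (‖x‖ + c) * B x = ∑ q, g q (φ q x) := by
  obtain ⟨σ, hσ, hσI, hσR⟩ := sigmoid
  obtain ⟨φ, hφ⟩ := cube (ℓ + 1)
  let R : ℝ := ‖φ‖
  have hR : 0 ≤ R := norm_nonneg _
  have hφR : ∀ q k, |φ q k| ≤ R := fun q k =>
    ((φ q).norm_coe_le_norm k).trans (norm_le_pi_norm φ q)
  let u : (Fin ℓ → ℝ) → ℝ := fun x => bump (‖x‖ + c)
  have hu : Continuous u := bump_continuous.comp (by fun_prop)
  let E : (Fin ℓ → ℝ) → Fin (ℓ + 1) → unitInterval := fun x =>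
    Fin.cons ⟨u x, bump_nonneg _, bump_le _⟩
      (fun j => ⟨u x * σ (x j), mul_nonneg (bump_nonneg _) (hσI _).1,
        mul_le_one₀ (bump_le _) (hσI _).1 (hσI _).2⟩)
  have hE : Continuous E := by
    refine continuous_pi fun j => ?_
    refine Fin.cases ?_ (fun j => ?_) j
    · exact hu.subtype_mk _
    · exact Continuous.subtype_mk (hu.mul (hσ.comp (continuous_apply j))) _
  have hE0 : ∀ x, u x = 0 → E x = 0 := by
    intro x hx
    funext j
    refine Fin.cases ?_ (fun j => ?_) j
    · exact Subtype.ext hx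
    · apply Subtype.ext
      change u x * σ (x j) = 0
      rw [hx, zero_mul]
  let T : ℝ → ℝ := fun s => stair 4 (s + c)
  have hT : Continuous T := (stair_continuous (by norm_num)).comp (by fun_prop)
  refine ⟨fun o => o.elim (fun x => ‖x‖) (fun q x => φ q (E x) + (2 * R + 2) * T ‖x‖), ?_, ?_⟩
  · rintro (_ | q)
    · exact continuous_norm
    · exact ((φ q).continuous.comp hE).add (continuous_const.mul (hT.comp continuous_norm))
  intro B hB
  have hF : ∀ i : ℤ, ∃ F : C(Fin (ℓ + 1) → unitInterval, ℝ), F 0 = 0 ∧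
      ∀ x, u x ≠ 0 → ⌊‖x‖ + c⌋ = i → F (E x) = u x * B x := by
    intro i
    obtain ⟨ρ, hρ, hρR, hρσ⟩ := hσR (|(i:ℝ)| + 1 + |c|) (by positivity)
    let b : (Fin ℓ → ℝ) → ℝ := fun y => B (fun j => ρ (y j))
    have hb : Continuous b := hB.comp (continuous_pi fun j => hρ.comp (continuous_apply j))
    obtain ⟨M, hM⟩ := (isCompact_closedBall (0 : Fin ℓ → ℝ) (|(i:ℝ)| + 1 + |c|)).exists_bound_of_continuousOn hB.continuousOn
    have hbM : ∀ y, |b y| ≤ M := fun y => hM _ (by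
      rw [mem_closedBall_zero_iff, pi_norm_le_iff_of_nonneg (by positivity)]
      exact fun j => hρR _)
    refine ⟨⟨fun k => (k 0 : ℝ) * b (fun j => (k (Fin.succ j) : ℝ) / (k 0 : ℝ)),
      cone_cont b hb M hbM (fun k : Fin (ℓ + 1) → unitInterval => (k 0 : ℝ)) (by fun_prop)
        (fun k j => (k (Fin.succ j) : ℝ)) (by fun_prop)⟩, ?_, ?_⟩
    · simp
    · intro x hx hi
      change u x * B (fun j => ρ (u x * σ (x j) / u x)) = u x * B x
      congr 2
      funext j
      rw [mul_div_cancel_left₀ _ hx]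
      apply hρσ
      have h1 : |x j| ≤ ‖x‖ := norm_le_pi_norm x j
      have h2 := Int.lt_floor_add_one (‖x‖ + c)
      rw [hi] at h2
      linarith [le_abs_self (i:ℝ), neg_abs_le c]
  choose F hF0 hFE using hF
  choose g hg using fun i => hφ (F i)
  choose G hG hGg using fun q => glue R hR (fun i => g i q)
  refine ⟨fun o => o.elim (fun s => - ∑ q, G q (φ q 0 + (2 * R + 2) * T s)) (fun q => G q), ?_, ?_⟩
  · rintro (_ | q)
    · refine Continuous.neg (continuous_finsetSum _ fun q _ => (hG q).comp ?_)
      exact continuous_const.add (continuous_const.mul hT)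
    · exact hG q
  intro x
  rw [Fintype.sum_option]
  simp only [Option.elim]
  change u x * B x = _
  by_cases hx : u x = 0
  · rw [hE0 x hx, hx]; ring
  · have hTx : T ‖x‖ = (⌊‖x‖ + c⌋ : ℤ) := stair_of_bump hx
    rw [hTx]
    simp only [hGg _ _ _ (hφR _ _)]
    rw [← hg, ← hg, hF0, hFE _ x hx rfl]
    ring

lemma euclid (ℓ : ℕ) : ∃ (r : ℕ) (φ : Fin r → (Fin ℓ → ℝ) → ℝ),
    (∀ q, Continuous (φ q)) ∧ ∀ f : (Fin ℓ → ℝ) → ℝ, Continuous f →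
      ∃ g : Fin r → ℝ → ℝ, (∀ q, Continuous (g q)) ∧ ∀ x, f x = ∑ q, g q (φ q x) := by
  obtain ⟨φ, hφ, hφg⟩ := colour ℓ 0
  obtain ⟨ψ, hψ, hψg⟩ := colour ℓ (1 / 2)
  let ι := Option (Fin (4 * (ℓ + 1) + 4)) ⊕ Option (Fin (4 * (ℓ + 1) + 4))
  let e : Fin (Fintype.card ι) ≃ ι := (Fintype.equivFin ι).symm
  refine ⟨Fintype.card ι, fun q => Sum.elim φ ψ (e q), fun q => ?_, fun f hf => ?_⟩
  · change Continuous (Sum.elim φ ψ (e q))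
    cases e q
    · exact hφ _
    · exact hψ _
  have hpos : ∀ x : Fin ℓ → ℝ, 0 < bump (‖x‖ + 0) + bump (‖x‖ + 1 / 2) := fun x => bump_add_pos _
  have hB : Continuous fun x : Fin ℓ → ℝ => f x / (bump (‖x‖ + 0) + bump (‖x‖ + 1 / 2)) := by
    refine hf.div (Continuous.add (bump_continuous.comp (by fun_prop))
      (bump_continuous.comp (by fun_prop))) fun x => (hpos x).ne'
  obtain ⟨g, hg, hgx⟩ := hφg _ hB
  obtain ⟨h, hh, hhx⟩ := hψg _ hB
  refine ⟨fun q => Sum.elim g h (e q), fun q => ?_, fun x => ?_⟩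
  · change Continuous (Sum.elim g h (e q))
    cases e q
    · exact hg _
    · exact hh _
  · rw [e.sum_comp (fun i => (Sum.elim g h i) (Sum.elim φ ψ i x)), Fintype.sum_sum_type]
    simp only [Sum.elim_inl, Sum.elim_inr]
    rw [← hgx, ← hhx, ← add_mul]
    exact (mul_div_cancel₀ _ (hpos x).ne').symm

end KS

/-- Every space homeomorphic to a closed subspace of some Euclidean space
has a finite basic family: finitely many continuous `φ q : X → ℝ` such that
every continuous `f : X → ℝ` is `∑ q, g q ∘ φ q` for continuous `g q`. -/
theorem finite_basic_family_of_closed_in_euclidean (X : Type*) [TopologicalSpace X]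
    (hX : ∃ (ℓ : ℕ) (s : Set (Fin ℓ → ℝ)), IsClosed s ∧ Nonempty (X ≃ₜ s)) :
    ∃ (r : ℕ) (φ : Fin r → X → ℝ),
      (∀ q, Continuous (φ q)) ∧
      ∀ f : X → ℝ, Continuous f →
        ∃ g : Fin r → ℝ → ℝ,
          (∀ q, Continuous (g q)) ∧
          ∀ x : X, f x = ∑ q : Fin r, g q (φ q x) := by
  obtain ⟨ℓ, s, hs, ⟨e⟩⟩ := hX
  obtain ⟨r, φ, hφ, hφg⟩ := KS.euclid ℓ
  refine ⟨r, fun q x => φ q (e x), fun q => (hφ q).comp (continuous_subtype_val.comp e.continuous),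
    fun f hf => ?_⟩
  obtain ⟨F, -, hF⟩ := ContinuousMap.exists_restrict_eq_forall_mem_of_closed
    (s := s) ⟨fun y : s => f (e.symm y), hf.comp e.symm.continuous⟩ (t := Set.univ)
    (fun _ => Set.mem_univ _) Set.univ_nonempty hs
  obtain ⟨g, hg, hgx⟩ := hφg F F.continuous
  refine ⟨g, hg, fun x => ?_⟩
  rw [← hgx]
  have := congrArg (fun h : C(s, ℝ) => h (e x)) hF
  simpa using this.symm
end

section
/- Let X be a topological space homeomorphic to a closed subspace of some Euclidean space. Then for every m, n ∈ ℕ with m, n ≥ 1 there is an r ∈ ℕ and continuous functions ψ^{pq} : X → ℝ^n, for q = 1,…,r and p = 1,…,m, such that every continuous function f : X^m → ℝ^n can be written f(x_1,…,x_m) = Σ_{q=1}^{r} g_q(Σ_{p=1}^{m} ψ^{pq}(x_p)) for some continuous functions g_1,…,g_r : ℝ^n → ℝ^n. -/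
open Set Filter Topology

/-! ### Elementary helpers -/

lemma kst_rep {X K : Type*} (fl : X → K) (f : X → ℝ) (e C : ℝ) (hC : 0 ≤ C)
    (hf : ∀ x x', fl x = fl x' → |f x - f x'| ≤ e) (hb : ∀ x, |f x| ≤ C) :
    ∃ a : K → ℝ, (∀ x, |f x - a (fl x)| ≤ e) ∧ ∀ k, |a k| ≤ C := by
  classical
  refine ⟨fun k => if h : ∃ x, fl x = k then f h.choose else 0, ?_, ?_⟩
  · intro x
    have h : ∃ y, fl y = fl x := ⟨x, rfl⟩
    simp only [h, dite_true]
    exact hf _ _ h.choose_spec.symm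
  · intro k
    by_cases h : ∃ x, fl x = k
    · simp only [h, dite_true]
      exact hb _
    · simp only [h, dite_false]
      simpa using hC

lemma kst_rat (a : ℤ → ℝ) (ε : ℝ) (hε : 0 < ε) :
    ∃ u : ℤ → ℚ, Function.Injective u ∧ ∀ k, |((u k : ℚ) : ℝ) - a k| ≤ ε := by
  obtain ⟨η, h0, h1⟩ := exists_rat_btwn hε
  have hη : (0 : ℚ) < η := by exact_mod_cast h0
  set c : ℤ → ℚ := fun k => 1 / (2 + (Encodable.encode k : ℚ)) with hc
  have hc0 : ∀ k, 0 < c k := fun k => by positivity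
  have hc1 : ∀ k, c k < 1 := fun k => by
    rw [hc]
    simp only
    rw [div_lt_one (by positivity)]
    have : (0 : ℚ) ≤ (Encodable.encode k : ℚ) := by positivity
    linarith
  refine ⟨fun k => η * (⌊a k / η⌋ + c k), ?_, ?_⟩
  · intro k l hkl
    simp only at hkl
    have h2 := mul_left_cancel₀ hη.ne' hkl
    have h3 : Int.fract ((⌊a k / η⌋ : ℚ) + c k) = Int.fract ((⌊a l / η⌋ : ℚ) + c l) := by rw [h2]
    rw [Int.fract_intCast_add, Int.fract_intCast_add,
      Int.fract_eq_self.2 ⟨(hc0 k).le, hc1 k⟩, Int.fract_eq_self.2 ⟨(hc0 l).le, hc1 l⟩] at h3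
    simp only [hc, one_div, inv_inj, add_right_inj] at h3
    exact Encodable.encode_injective (by exact_mod_cast h3)
  · intro k
    have e1 : (((η * (⌊a k / η⌋ + c k) : ℚ)) : ℝ) - a k
        = η * (((c k : ℚ) : ℝ) - Int.fract (a k / η)) := by
      push_cast
      rw [Int.fract]
      have : (η : ℝ) ≠ 0 := h0.ne'
      field_simp
      ring
    simp only
    rw [e1, abs_mul, abs_of_pos h0]
    have h4 : |((c k : ℚ) : ℝ) - Int.fract (a k / η)| ≤ 1 := by
      have a1 : (0 : ℝ) < ((c k : ℚ) : ℝ) := by exact_mod_cast hc0 k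
      have a2 : ((c k : ℚ) : ℝ) < 1 := by exact_mod_cast hc1 k
      have a3 := Int.fract_nonneg (a k / (η : ℝ))
      have a4 := Int.fract_lt_one (a k / (η : ℝ))
      rw [abs_le]; constructor <;> linarith
    nlinarith

lemma kst_interp {K : Type*} (s : Set K) (hs : s.Finite) (v : K → ℝ)
    (hv : Function.Injective v) (c : K → ℝ) (C : ℝ) (hc : ∀ k, |c k| ≤ C) (hC : 0 ≤ C) :
    ∃ g : C(ℝ, ℝ), (∀ t, |g t| ≤ C) ∧ ∀ k ∈ s, g (v k) = c k := by
  classical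
  set p := Lagrange.interpolate hs.toFinset v c
  refine ⟨⟨fun t => max (-C) (min C (p.eval t)), by fun_prop⟩, ?_, ?_⟩
  · intro t
    simp only [ContinuousMap.coe_mk, abs_le]
    exact ⟨le_max_left _ _, max_le (by linarith) (min_le_left _ _)⟩
  · intro k hk
    have h1 : p.eval (v k) = c k :=
      Lagrange.eval_interpolate_at_node c hv.injOn (hs.mem_toFinset.2 hk)
    have h2 := abs_le.1 (hc k)
    simp only [ContinuousMap.coe_mk, h1]
    rw [min_eq_right h2.2, max_eq_right h2.1]

lemma kst_linindep (ι : Type) [Fintype ι] : ∃ l : ι → ℝ, LinearIndependent ℚ l := by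
  have h : Cardinal.mk ι ≤ Module.rank ℚ ℝ := by
    rw [Real.rank_rat_real]
    exact (Cardinal.lt_aleph0_of_finite ι).le.trans Cardinal.aleph0_le_continuum
  obtain ⟨b⟩ := Module.Free.exists_basis (R := ℚ) (M := ℝ)
  rw [← b.2.mk_eq_rank''] at h
  obtain ⟨e⟩ := Cardinal.le_def _ _ |>.1 h
  exact ⟨b.2 ∘ e, b.2.linearIndependent.comp e e.injective⟩

lemma kst_floor_locally (y : ℝ) (hy : 0 < |y - round y|) : ∀ᶠ z in 𝓝 y, ⌊z⌋ = ⌊y⌋ := by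
  have h1 : (⌊y⌋ : ℝ) < y := by
    refine lt_of_le_of_ne (Int.floor_le y) ?_
    intro h
    rw [← h] at hy
    simp at hy
  have h2 := Int.lt_floor_add_one y
  filter_upwards [Ioo_mem_nhds h1 h2] with z hz
  exact Int.floor_eq_iff.2 ⟨hz.1.le, hz.2⟩

lemma kst_bad_unique (r : ℕ) (z : ℝ) (q q' : Fin r)
    (h : |(z - q / r) - round (z - (q : ℝ) / r)| < 1 / (2 * r))
    (h' : |(z - q' / r) - round (z - (q' : ℝ) / r)| < 1 / (2 * r)) : q = q' := by
  have hr : (0 : ℝ) < r := by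
    have := q.pos
    exact_mod_cast this
  set a := round (z - (q : ℝ) / r)
  set b := round (z - (q' : ℝ) / r)
  have e : |((q : ℝ) - q') - r * ((b : ℝ) - a)| < 1 := by
    have e1 : ((q : ℝ) - q') - r * ((b : ℝ) - a)
      = r * (((z - q' / r) - b) - ((z - q / r) - a)) := by
      field_simp
      ring
    rw [e1, abs_mul, abs_of_pos hr]
    have e2 := abs_sub ((z - q' / r) - (b : ℝ)) ((z - q / r) - a)
    have e3 : |(z - q' / r) - (b : ℝ) - ((z - q / r) - a)| < 1 / r := by
      have : (1 : ℝ) / (2 * r) + 1 / (2 * r) = 1 / r := by field_simp; norm_num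
      linarith
    calc _ < (r : ℝ) * (1 / r) := mul_lt_mul_of_pos_left e3 hr
      _ = 1 := by field_simp
  have e' : |((q : ℤ) - q') - r * (b - a)| < 1 := by exact_mod_cast e
  have e4 : ((q : ℤ) - q') - r * (b - a) = 0 := Int.abs_lt_one_iff.1 e'
  have e5 : ((q : ℤ) - q') = 0 := by
    apply Int.eq_zero_of_abs_lt_dvd (m := r) ⟨b - a, by linarith⟩
    have := q.2
    have := q'.2
    rw [abs_lt]
    constructor <;> omega
  exact Fin.ext (by omega)

/-! ### The compact superposition theorem -/

/-- The interval `[-1, 1]`. -/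
abbrev KstI : Type := Set.Icc (-1 : ℝ) 1

/-- The inner function `x ↦ ∑ j, l j * φ (x j)`. -/
noncomputable def kstPsi {ι : Type} [Fintype ι] (l : ι → ℝ) (φ : C(KstI, ℝ)) :
    C(ι → KstI, ℝ) :=
  ∑ j, l j • φ.comp (⟨fun x => x j, continuous_apply j⟩ : C(ι → KstI, KstI))

lemma kstPsi_apply {ι : Type} [Fintype ι] (l : ι → ℝ) (φ : C(KstI, ℝ)) (x : ι → KstI) :
    kstPsi l φ x = ∑ j, l j * φ (x j) := by
  simp [kstPsi, ContinuousMap.sum_apply]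

lemma kstPsi_continuous {ι : Type} [Fintype ι] (l : ι → ℝ) :
    Continuous (kstPsi l) := by
  unfold kstPsi
  refine continuous_finsetSum _ fun j _ => ?_
  exact (ContinuousMap.continuous_precomp (Z := ℝ)
    (⟨fun x => x j, continuous_apply j⟩ : C(ι → KstI, KstI))).const_smul (l j)

lemma kst_one {ι : Type} [Fintype ι] (l : ι → ℝ) (hl : LinearIndependent ℚ l)
    (r : ℕ) (hr : 0 < r) (F : C(ι → KstI, ℝ)) (η C : ℝ) (hC : ∀ x, |F x| ≤ C) (hC0 : 0 ≤ C)
    (n : ℕ) (hn : 0 < n)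
    (hF : ∀ x x' : ι → KstI, (∀ j, |(x j : ℝ) - x' j| < 1 / n) → |F x - F x'| ≤ η)
    (φ₀ : C(KstI, ℝ)) (ε : ℝ) (hε : 0 < ε)
    (hφ : ∀ x x' : KstI, |(x : ℝ) - x'| < 1 / n → |φ₀ x - φ₀ x'| ≤ ε) (o : ℝ) :
    ∃ φ : C(KstI, ℝ), (∀ x, |φ x - φ₀ x| ≤ 2 * ε) ∧ ∃ g : C(ℝ, ℝ), (∀ t, |g t| ≤ C / r) ∧
      ∀ x : ι → KstI,
        (∀ j, 1 / (2 * r) ≤ |(n * (x j : ℝ) - o) - round (n * (x j : ℝ) - o)|) →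
        |F x / r - g (kstPsi l φ x)| ≤ η / r := by
  classical
  have hr' : (0 : ℝ) < r := by exact_mod_cast hr
  have hn' : (0 : ℝ) < n := by exact_mod_cast hn
  set fl : KstI → ℤ := fun x => ⌊(n * (x : ℝ) - o)⌋ with hfl
  have hclose : ∀ x x' : KstI, fl x = fl x' → |(x : ℝ) - x'| < 1 / n := by
    intro x x' h
    have h1 := Int.abs_sub_lt_one_of_floor_eq_floor h
    have e : (n * (x : ℝ) - o) - (n * (x' : ℝ) - o) = n * ((x : ℝ) - x') := by ring
    rw [e, abs_mul, abs_of_pos hn'] at h1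
    rw [lt_div_iff₀ hn']
    linarith
  obtain ⟨a, ha, -⟩ := kst_rep fl φ₀ ε ‖φ₀‖ (norm_nonneg _)
    (fun x x' h => hφ x x' (hclose x x' h)) (fun x => φ₀.norm_coe_le_norm x)
  obtain ⟨u, hu, hua⟩ := kst_rat a ε hε
  -- the good set
  set s : Set KstI := {x | 1 / (2 * (r : ℝ)) ≤ |(n * (x : ℝ) - o) - round (n * (x : ℝ) - o)|} with hs
  have hsc : IsClosed s := by
    have : s = {x : KstI | 1 / (2 * (r : ℝ)) ≤ ‖((n * (x : ℝ) - o : ℝ) : UnitAddCircle)‖} := by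
      ext x
      simp only [hs, UnitAddCircle.norm_eq]
    rw [this]
    refine isClosed_le continuous_const ?_
    refine continuous_norm.comp ?_
    exact (AddCircle.continuous_mk' (1 : ℝ)).comp (by fun_prop)
  have hec : Continuous (fun x : s => ((u (fl x.1) : ℚ) : ℝ) - φ₀ x.1) := by
    refine Continuous.sub ?_ (by fun_prop)
    rw [continuous_iff_continuousAt]
    intro x
    have hx : 0 < |(n * (x.1 : ℝ) - o) - round (n * (x.1 : ℝ) - o)| :=
      lt_of_lt_of_le (by positivity) x.2
    have h1 := kst_floor_locally _ hx
    have h2 : Tendsto (fun y : s => n * (y.1 : ℝ) - o) (𝓝 x) (𝓝 (n * (x.1 : ℝ) - o)) := by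
      have : Continuous (fun y : s => n * (y.1 : ℝ) - o) := by fun_prop
      exact this.tendsto x
    refine (continuousAt_const (y := ((u (fl x.1) : ℚ) : ℝ))).congr ?_
    filter_upwards [h2.eventually h1] with y hy
    simp only [hfl, hy]
  obtain ⟨E, hE1, hE2⟩ := ContinuousMap.exists_restrict_eq_forall_mem_of_closed
    (⟨_, hec⟩ : C(s, ℝ)) (t := Set.Icc (-(2 * ε)) (2 * ε)) (by
      intro x
      rw [Set.mem_Icc, ← abs_le]
      have h1 := ha x.1
      have h2 := hua (fl x.1)
      simp only [ContinuousMap.coe_mk]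
      have h3 := abs_sub_le ((u (fl x.1) : ℚ) : ℝ) (a (fl x.1)) (φ₀ x.1)
      rw [abs_sub_comm (a (fl x.1))] at h3
      linarith) ⟨0, by constructor <;> linarith⟩ hsc
  have hEs : ∀ x ∈ s, φ₀ x + E x = u (fl x) := by
    intro x hx
    have := DFunLike.congr_fun hE2 (⟨x, hx⟩ : s)
    simp only [ContinuousMap.restrict_apply, ContinuousMap.coe_mk] at this
    rw [this]; ring
  refine ⟨φ₀ + E, ?_, ?_⟩
  · intro x
    simp only [ContinuousMap.add_apply, add_sub_cancel_left]
    exact abs_le.2 (hE1 x)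
  -- the outer function
  set V : (ι → ℤ) → ℝ := fun κ => ∑ j, l j * ((u (κ j) : ℚ) : ℝ) with hV
  have hVinj : Function.Injective V := by
    intro κ κ' h
    have h1 : ∑ j, (u (κ j) - u (κ' j)) • l j = 0 := by
      simp only [hV] at h
      rw [← sub_eq_zero, ← Finset.sum_sub_distrib] at h
      rw [← h]
      refine Finset.sum_congr rfl fun j _ => ?_
      rw [Rat.smul_def]
      push_cast
      ring
    have h2 := Fintype.linearIndependent_iff.1 hl _ h1
    funext j
    exact hu (sub_eq_zero.1 (h2 j))
  obtain ⟨c, hc1, hc2⟩ := kst_rep (fun (x : ι → KstI) (j : ι) => fl (x j)) F η C hC0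
    (fun x x' h => hF x x' fun j => hclose _ _ (congrFun h j)) hC
  have hfin : (Set.range (fun (x : ι → KstI) (j : ι) => fl (x j))).Finite := by
    have h1 : (Set.range fl).Finite := by
      refine (Set.finite_Icc ⌊-(n : ℝ) - o⌋ ⌊(n : ℝ) - o⌋).subset ?_
      rintro _ ⟨x, rfl⟩
      have := x.2.1
      have := x.2.2
      constructor
      · exact Int.floor_le_floor (by nlinarith)
      · exact Int.floor_le_floor (by nlinarith)
    refine (Set.Finite.pi' (fun _ : ι => h1)).subset ?_
    rintro _ ⟨x, rfl⟩ j
    exact ⟨x j, rfl⟩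
  obtain ⟨g, hg1, hg2⟩ := kst_interp _ hfin V hVinj (fun κ => c κ / r) (C / r)
    (fun κ => by
      rw [abs_div, abs_of_pos hr']
      exact div_le_div_of_nonneg_right (hc2 κ) hr'.le) (by positivity)
  refine ⟨g, hg1, ?_⟩
  intro x hx
  have e1 : kstPsi l (φ₀ + E) x = V (fun j => fl (x j)) := by
    rw [kstPsi_apply]
    refine Finset.sum_congr rfl fun j _ => ?_
    rw [ContinuousMap.add_apply, hEs _ (hx j)]
  rw [e1, hg2 _ ⟨x, rfl⟩, ← sub_div, abs_div, abs_of_pos hr']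
  exact div_le_div_of_nonneg_right (hc1 x) hr'.le

lemma kst_dense {ι : Type} [Fintype ι] (l : ι → ℝ) (hl : LinearIndependent ℚ l)
    (r : ℕ) (hr : r = 4 * Fintype.card ι + 1) (F : C(ι → KstI, ℝ)) (hF0 : F ≠ 0)
    (φ₀ : Fin r → C(KstI, ℝ)) (ε : ℝ) (hε : 0 < ε) :
    ∃ φ : Fin r → C(KstI, ℝ), dist φ φ₀ < ε ∧
      ∃ g : Fin r → C(ℝ, ℝ), (∀ q t, |g q t| ≤ ‖F‖) ∧
        ‖F - ∑ q, (g q).comp (kstPsi l (φ q))‖ < 2 / 3 * ‖F‖ := by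
  classical
  set M := Fintype.card ι with hM
  have hr0 : 0 < r := by omega
  have hr' : (0 : ℝ) < r := by exact_mod_cast hr0
  have hr1 : (1 : ℝ) ≤ r := by exact_mod_cast hr0
  have hFp : 0 < ‖F‖ := norm_pos_iff.2 hF0
  set η := ‖F‖ / 10 with hη
  obtain ⟨δ, hδ, hFδ⟩ := Metric.uniformContinuous_iff.1
    (CompactSpace.uniformContinuous_of_continuous F.continuous) η (by positivity)
  have hφδ : ∀ q, ∃ δ' > 0, ∀ x x' : KstI, dist x x' < δ' → dist (φ₀ q x) (φ₀ q x') < ε / 4 := by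
    intro q
    obtain ⟨δ', h1, h2⟩ := Metric.uniformContinuous_iff.1
      (CompactSpace.uniformContinuous_of_continuous (φ₀ q).continuous) (ε / 4) (by positivity)
    exact ⟨δ', h1, fun x x' h => h2 h⟩
  choose δ' hδ' hφδ' using hφδ
  have hex : ∃ n : ℕ, 0 < n ∧ (1 : ℝ) / n < δ ∧ ∀ q, (1 : ℝ) / n < δ' q := by
    have h1 : Tendsto (fun n : ℕ => (1 : ℝ) / n) atTop (𝓝 0) := tendsto_one_div_atTop_nhds_zero_nat
    have h2 : ∀ᶠ n : ℕ in atTop, ∀ q, (1 : ℝ) / n < δ' q :=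
      Filter.eventually_all.2 fun q => h1.eventually_lt_const (hδ' q)
    exact ((eventually_gt_atTop 0).and ((h1.eventually_lt_const hδ).and h2)).exists
  obtain ⟨n, hn, hn1, hn2⟩ := hex
  have hn' : (0 : ℝ) < 1 / n := by positivity
  have key : ∀ q : Fin r, _ := fun q => kst_one l hl r hr0 F η ‖F‖ (fun x => F.norm_coe_le_norm x)
    hFp.le n hn (fun x x' h => by
      have : dist x x' < δ := by
        refine lt_of_le_of_lt ((dist_pi_le_iff hn'.le).2 fun j => ?_) hn1
        exact (h j).le
      exact (hFδ this).le) (φ₀ q) (ε / 4) (by positivity)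
      (fun x x' h => (hφδ' q x x' (lt_trans h (hn2 q))).le) ((q : ℝ) / r)
  choose φ hφ g hg1 hg2 using key
  refine ⟨φ, ?_, g, ?_, ?_⟩
  · refine lt_of_le_of_lt ((dist_pi_le_iff (by positivity : (0 : ℝ) ≤ ε / 2)).2 fun q => ?_)
      (by linarith)
    refine (ContinuousMap.dist_le (by positivity)).2 fun x => ?_
    have := hφ q x
    rw [Real.dist_eq]
    linarith
  · intro q t
    exact (hg1 q t).trans (div_le_self hFp.le hr1)
  have hb : ∀ x, ‖(F - ∑ q, (g q).comp (kstPsi l (φ q))) x‖ ≤ 3 / 5 * ‖F‖ := by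
    intro x
    set B : Finset (Fin r) := Finset.univ.filter fun q => ∃ j,
      |(n * (x j : ℝ) - (q : ℝ) / r) - round (n * (x j : ℝ) - (q : ℝ) / r)| < 1 / (2 * r) with hB
    have hBcard : B.card ≤ M := by
      have h1 : ∀ q : Fin r, q ∈ B → ∃ j,
          |(n * (x j : ℝ) - (q : ℝ) / r) - round (n * (x j : ℝ) - (q : ℝ) / r)| < 1 / (2 * r) := by
        intro q hq
        simpa [hB] using hq
      choose f hf using h1
      have h2 : (B.attach.image fun q => f q.1 q.2).card = B.attach.card := by
        refine Finset.card_image_of_injective _ fun q q' h => ?_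
        have a1 := hf q.1 q.2
        have a2 := hf q'.1 q'.2
        have h : f q.1 q.2 = f q'.1 q'.2 := h
        rw [← h] at a2
        exact Subtype.ext (kst_bad_unique r _ _ _ a1 a2)
      rw [← Finset.card_attach, ← h2, hM]
      exact Finset.card_le_univ _
    have e1 : (F - ∑ q, (g q).comp (kstPsi l (φ q))) x
        = ∑ q, (F x / r - g q (kstPsi l (φ q) x)) := by
      rw [Finset.sum_sub_distrib]
      simp [ContinuousMap.sum_apply]
      field_simp
    rw [e1]
    have e2 : ∀ q, ‖F x / r - g q (kstPsi l (φ q) x)‖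
        ≤ η / r + if q ∈ B then 2 * ‖F‖ / r else 0 := by
      intro q
      by_cases hq : q ∈ B
      · rw [if_pos hq]
        have h1 := F.norm_coe_le_norm x
        have h2 := hg1 q (kstPsi l (φ q) x)
        have h3 := norm_sub_le (F x / r) (g q (kstPsi l (φ q) x))
        have h4 : ‖F x / r‖ ≤ ‖F‖ / r := by
          rw [norm_div, Real.norm_natCast]
          exact div_le_div_of_nonneg_right h1 hr'.le
        rw [← Real.norm_eq_abs] at h2
        have h5 : 2 * ‖F‖ / r = ‖F‖ / r + ‖F‖ / r := by ring
        have h6 : 0 ≤ η / r := by positivity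
        linarith
      · rw [if_neg hq, add_zero]
        apply hg2
        intro j
        by_contra hj
        apply hq
        simp only [hB, Finset.mem_filter, Finset.mem_univ, true_and]
        exact ⟨j, not_le.1 hj⟩
    refine (norm_sum_le _ _).trans ((Finset.sum_le_sum fun q _ => e2 q).trans ?_)
    rw [Finset.sum_add_distrib, ← Finset.sum_filter]
    simp only [Finset.sum_const, Finset.card_univ, Fintype.card_fin, nsmul_eq_mul,
      Finset.filter_mem_eq_inter, Finset.univ_inter]
    have h7 : (r : ℝ) * (η / r) = η := by field_simp
    have h8 : (B.card : ℝ) * (2 * ‖F‖ / r) ≤ 1 / 2 * ‖F‖ := by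
      have h9 : (B.card : ℝ) ≤ M := by exact_mod_cast hBcard
      have h10 : (r : ℝ) = 4 * M + 1 := by rw [hr]; push_cast; ring
      have h11 : (B.card : ℝ) * (2 * ‖F‖ / r) = (B.card * 2 / r) * ‖F‖ := by ring
      rw [h11]
      refine mul_le_mul_of_nonneg_right ?_ hFp.le
      rw [div_le_iff₀ hr', h10]
      linarith
    rw [h7]
    linarith
  refine lt_of_le_of_lt ((ContinuousMap.norm_le _ (by positivity)).2 hb) ?_
  linarith

/-- The parameters of inner functions admitting a good one-step approximation of `F`. -/
def kstOmega {ι : Type} [Fintype ι] (l : ι → ℝ) (r : ℕ) (F : C(ι → KstI, ℝ)) :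
    Set (Fin r → C(KstI, ℝ)) :=
  {φ | F = 0 ∨ ∃ g : Fin r → C(ℝ, ℝ), (∀ q t, |g q t| ≤ ‖F‖) ∧
        ‖F - ∑ q, (g q).comp (kstPsi l (φ q))‖ < 2 / 3 * ‖F‖}

lemma kstOmega_open {ι : Type} [Fintype ι] (l : ι → ℝ) (r : ℕ) (F : C(ι → KstI, ℝ)) :
    IsOpen (kstOmega l r F) := by
  by_cases hF : F = 0
  · have : kstOmega l r F = Set.univ := by
      ext φ
      simp [kstOmega, hF]
    rw [this]
    exact isOpen_univ
  have : kstOmega l r F = ⋃ g : {g : Fin r → C(ℝ, ℝ) // ∀ q t, |g q t| ≤ ‖F‖},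
      {φ | ‖F - ∑ q, (g.1 q).comp (kstPsi l (φ q))‖ < 2 / 3 * ‖F‖} := by
    ext φ
    simp [kstOmega, hF]
  rw [this]
  refine isOpen_iUnion fun g => isOpen_lt ?_ continuous_const
  refine continuous_norm.comp (continuous_const.sub ?_)
  refine continuous_finsetSum _ fun q _ => ?_
  exact (ContinuousMap.continuous_postcomp (g.1 q)).comp
    ((kstPsi_continuous l).comp (continuous_apply q))

lemma kstOmega_dense {ι : Type} [Fintype ι] (l : ι → ℝ) (hl : LinearIndependent ℚ l)
    (r : ℕ) (hr : r = 4 * Fintype.card ι + 1) (F : C(ι → KstI, ℝ)) :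
    Dense (kstOmega l r F) := by
  by_cases hF : F = 0
  · have : kstOmega l r F = Set.univ := by
      ext φ
      simp [kstOmega, hF]
    rw [this]
    exact dense_univ
  rw [Metric.dense_iff]
  intro φ₀ ε hε
  obtain ⟨φ, h1, g, h2, h3⟩ := kst_dense l hl r hr F hF φ₀ ε hε
  exact ⟨φ, h1, Or.inr ⟨g, h2, h3⟩⟩

lemma kst_step {ι : Type} [Fintype ι] (l : ι → ℝ) (hl : LinearIndependent ℚ l)
    (r : ℕ) (hr : r = 4 * Fintype.card ι + 1) :
    ∃ φ : Fin r → C(KstI, ℝ), ∀ F : C(ι → KstI, ℝ), ∃ g : Fin r → C(ℝ, ℝ),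
      (∀ q t, |g q t| ≤ 2 * ‖F‖) ∧
      ‖F - ∑ q, (g q).comp (kstPsi l (φ q))‖ ≤ 3 / 4 * ‖F‖ := by
  have hd : Dense (⋂ n, kstOmega l r (TopologicalSpace.denseSeq C(ι → KstI, ℝ) n)) :=
    dense_iInter_of_isOpen (fun n => kstOmega_open l r _) (fun n => kstOmega_dense l hl r hr _)
  obtain ⟨φ, hφ⟩ := hd.nonempty
  refine ⟨φ, fun F => ?_⟩
  by_cases hF : F = 0
  · refine ⟨fun _ => 0, ?_, ?_⟩
    · simp [hF]
    · simp [hF]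
  have hFp : 0 < ‖F‖ := norm_pos_iff.2 hF
  obtain ⟨n, hn⟩ := (TopologicalSpace.denseRange_denseSeq C(ι → KstI, ℝ)).exists_dist_lt F
    (ε := ‖F‖ / 30) (by positivity)
  set H := TopologicalSpace.denseSeq C(ι → KstI, ℝ) n with hH
  rw [dist_eq_norm] at hn
  have h1 : φ ∈ kstOmega l r H := Set.mem_iInter.1 hφ n
  have h2 : ‖H‖ ≤ 31 / 30 * ‖F‖ := by
    have := norm_sub_norm_le H F
    rw [norm_sub_rev] at this
    linarith
  have h3 : ‖F‖ ≤ ‖F - H‖ + ‖H‖ := by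
    have := norm_add_le (F - H) H
    simpa using this
  rcases h1 with h1 | ⟨g, hg1, hg2⟩
  · rw [h1] at h3 hn
    simp at h3 hn
    linarith
  refine ⟨g, fun q t => (hg1 q t).trans (by linarith), ?_⟩
  have h4 := norm_add_le (F - H) (H - ∑ q, (g q).comp (kstPsi l (φ q)))
  rw [sub_add_sub_cancel] at h4
  linarith

lemma kst_compact {ι : Type} [Fintype ι] (l : ι → ℝ) (hl : LinearIndependent ℚ l)
    (r : ℕ) (hr : r = 4 * Fintype.card ι + 1) :
    ∃ φ : Fin r → C(KstI, ℝ), ∀ F : C(ι → KstI, ℝ), ∃ g : Fin r → C(ℝ, ℝ),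
      ∀ x, F x = ∑ q, g q (kstPsi l (φ q) x) := by
  obtain ⟨φ, hφ⟩ := kst_step l hl r hr
  refine ⟨φ, fun F => ?_⟩
  choose g hg1 hg2 using hφ
  set S : C(ι → KstI, ℝ) → C(ι → KstI, ℝ) :=
    fun F => F - ∑ q, (g F q).comp (kstPsi l (φ q)) with hS
  set H : ℕ → C(ι → KstI, ℝ) := fun n => S^[n] F with hH
  have hH0 : H 0 = F := rfl
  have hHs : ∀ n, H (n + 1) = H n - ∑ q, (g (H n) q).comp (kstPsi l (φ q)) := by
    intro n
    simp only [hH, Function.iterate_succ_apply']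
    rfl
  have hHn : ∀ n, ‖H n‖ ≤ (3 / 4) ^ n * ‖F‖ := by
    intro n
    induction n with
    | zero => simp [hH0]
    | succ n ih =>
      rw [hHs, pow_succ]
      have := hg2 (H n)
      linarith
  have hgn : ∀ q n t, ‖g (H n) q t‖ ≤ (3 / 4) ^ n * (2 * ‖F‖) := by
    intro q n t
    have h1 := hg1 (H n) q t
    have h2 := hHn n
    rw [Real.norm_eq_abs]
    linarith
  have hsum : Summable fun n : ℕ => (3 / 4 : ℝ) ^ n * (2 * ‖F‖) :=
    (summable_geometric_of_lt_one (by norm_num) (by norm_num)).mul_right _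
  refine ⟨fun q => ⟨fun t => ∑' n, g (H n) q t,
    continuous_tsum (fun n => (g (H n) q).continuous) hsum (fun n t => hgn q n t)⟩, ?_⟩
  intro x
  simp only [ContinuousMap.coe_mk]
  have hs : ∀ q t, Summable fun n => g (H n) q t := fun q t =>
    Summable.of_norm_bounded hsum (fun n => hgn q n t)
  rw [← Summable.tsum_finsetSum (fun q _ => hs q _)]
  have e : ∀ n, ∑ q, g (H n) q (kstPsi l (φ q) x) = H n x - H (n + 1) x := by
    intro n
    rw [hHs]
    simp [ContinuousMap.sum_apply]
  simp only [e]
  have hpart : ∀ N, ∑ n ∈ Finset.range N, (H n x - H (n + 1) x) = F x - H N x := by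
    intro N
    rw [Finset.sum_range_sub', hH0]
  have hlim : Tendsto (fun N => H N x) atTop (𝓝 0) := by
    refine squeeze_zero_norm (a := fun n : ℕ => (3 / 4 : ℝ) ^ n * ‖F‖)
      (fun n => ((H n).norm_coe_le_norm x).trans (hHn n)) ?_
    have := (tendsto_pow_atTop_nhds_zero_of_lt_one (r := (3 / 4 : ℝ)) (by norm_num)
      (by norm_num)).mul_const ‖F‖
    simpa using this
  have hsm : Summable fun n => H n x - H (n + 1) x := by
    have := summable_sum (s := Finset.univ) (fun q _ => hs q (kstPsi l (φ q) x))
    simpa only [e] using this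
  have h1 := hsm.hasSum.tendsto_sum_nat
  simp only [hpart] at h1
  have h2 : Tendsto (fun N => F x - H N x) atTop (𝓝 (F x - 0)) := tendsto_const_nhds.sub hlim
  rw [sub_zero] at h2
  exact (tendsto_nhds_unique h1 h2).symm

/-- Compact superposition theorem in the form used below. -/
lemma kst_cube (ι : Type) [Fintype ι] :
    ∃ (r : ℕ) (α : Fin r → ι → ℝ → ℝ) (R : ℝ), 0 ≤ R ∧ (∀ q i, Continuous (α q i)) ∧
      (∀ q (y : ι → ℝ), |∑ i, α q i (y i)| ≤ R) ∧
      ∀ F : (ι → ℝ) → ℝ, Continuous F → ∃ g : Fin r → ℝ → ℝ, (∀ q, Continuous (g q)) ∧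
        ∀ y : ι → ℝ, (∀ i, y i ∈ Set.Icc (-1 : ℝ) 1) → F y = ∑ q, g q (∑ i, α q i (y i)) := by
  obtain ⟨l, hl⟩ := kst_linindep ι
  obtain ⟨φ, hφ⟩ := kst_compact l hl _ rfl
  have h11 : (-1 : ℝ) ≤ 1 := by norm_num
  refine ⟨_, fun q i t => l i * φ q (Set.projIcc (-1) 1 h11 t), ∑ q, ‖kstPsi l (φ q)‖,
    Finset.sum_nonneg fun q _ => norm_nonneg _, ?_, ?_, ?_⟩
  · intro q i
    exact continuous_const.mul ((φ q).continuous.comp continuous_projIcc)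
  · intro q y
    have h1 := (kstPsi l (φ q)).norm_coe_le_norm (fun i => Set.projIcc (-1) 1 h11 (y i))
    rw [kstPsi_apply, Real.norm_eq_abs] at h1
    refine h1.trans ?_
    exact Finset.single_le_sum (f := fun q => ‖kstPsi l (φ q)‖) (fun q _ => norm_nonneg _)
      (Finset.mem_univ q)
  · intro F hF
    obtain ⟨g, hg⟩ := hφ ⟨fun x => F fun i => (x i : ℝ), by fun_prop⟩
    refine ⟨fun q => g q, fun q => (g q).continuous, ?_⟩
    intro y hy
    have := hg (fun i => ⟨y i, hy i⟩)
    simp only [ContinuousMap.coe_mk, kstPsi_apply] at this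
    rw [this]
    refine Finset.sum_congr rfl fun q _ => ?_
    congr 1
    refine Finset.sum_congr rfl fun i _ => ?_
    show _ = l i * φ q (Set.projIcc (-1) 1 h11 (y i))
    rw [Set.projIcc_of_mem h11 (hy i)]

/-! ### Passing to the non-compact case -/

lemma kst_glue (h : ℤ → ℝ → ℝ) (hh : ∀ k, Continuous (h k)) :
    ∃ G : ℝ → ℝ, Continuous G ∧ ∀ (k : ℤ) (x : ℝ), |x - k| ≤ 1 / 3 → G x = h k x := by
  set w : ℝ → ℝ := fun y => max 0 (min 1 (3 - 6 * |y|)) with hw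
  have hw1 : ∀ y, |y| ≤ 1 / 3 → w y = 1 := by
    intro y hy
    simp only [hw]
    rw [min_eq_left (by linarith), max_eq_right (by norm_num)]
  have hw0 : ∀ y, 1 / 2 ≤ |y| → w y = 0 := by
    intro y hy
    simp only [hw]
    rw [max_eq_left]
    exact (min_le_right _ _).trans (by linarith)
  refine ⟨fun x => ∑ᶠ k : ℤ, w (x - k) * h k x, ?_, ?_⟩
  · refine continuous_finsum (fun k => ?_) ?_
    · have := hh k
      fun_prop
    · intro x
      refine ⟨Metric.ball x 1, Metric.ball_mem_nhds x one_pos, ?_⟩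
      refine (Set.finite_Icc ⌊x - 2⌋ ⌈x + 2⌉).subset ?_
      rintro k ⟨y, hy1, hy2⟩
      rw [Function.mem_support] at hy1
      have h1 : |y - k| < 1 / 2 := by
        by_contra hc
        apply hy1
        rw [hw0 _ (not_lt.1 hc), zero_mul]
      rw [Metric.mem_ball, Real.dist_eq] at hy2
      rw [abs_lt] at h1 hy2
      constructor
      · have : ((⌊x - 2⌋ : ℤ) : ℝ) ≤ k := (Int.floor_le _).trans (by linarith)
        exact_mod_cast this
      · have : (k : ℝ) ≤ ⌈x + 2⌉ := le_trans (by linarith) (Int.le_ceil _)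
        exact_mod_cast this
  · intro k x hx
    have hne : ∀ k' : ℤ, k' ≠ k → w (x - k') * h k' x = 0 := by
      intro k' hk
      rw [hw0, zero_mul]
      have h1 : (1 : ℝ) ≤ |(k : ℝ) - k'| := by
        have : 1 ≤ |k - k'| := Int.one_le_abs (sub_ne_zero.2 hk.symm)
        exact_mod_cast this
      have h2 := abs_sub_le (k : ℝ) x k'
      rw [abs_sub_comm (k : ℝ) x] at h2
      linarith
    show ∑ᶠ k : ℤ, w (x - k) * h k x = h k x
    rw [finsum_eq_single _ k hne, hw1 _ hx, one_mul]

/-- A bump function, supported near the integers. -/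
noncomputable def kstChi (x : ℝ) : ℝ := max 0 (min 1 (1 / 2 + Real.cos (2 * Real.pi * x)))

lemma kstChi_continuous : Continuous kstChi := by
  unfold kstChi
  fun_prop

lemma kstChi_nonneg (x : ℝ) : 0 ≤ kstChi x := le_max_left _ _

lemma kstChi_le_one (x : ℝ) : kstChi x ≤ 1 := max_le (by norm_num) (min_le_left _ _)

lemma kstChi_add (x : ℝ) : kstChi x + kstChi (x - 1 / 2) = 1 := by
  unfold kstChi
  have : 2 * Real.pi * (x - 1 / 2) = 2 * Real.pi * x - Real.pi := by ring
  rw [this, Real.cos_sub_pi]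
  set c := Real.cos (2 * Real.pi * x)
  rcases le_total 1 (1 / 2 + c) with h1 | h1
  · rw [min_eq_left h1, min_eq_right (by linarith), max_eq_right (by norm_num),
      max_eq_left (by linarith)]
    norm_num
  · rw [min_eq_right h1]
    rcases le_total 0 (1 / 2 + c) with h2 | h2
    · rw [max_eq_right h2, min_eq_right (by linarith), max_eq_right (by linarith)]
      ring
    · rw [max_eq_left h2, min_eq_left (by linarith), max_eq_right (by norm_num)]
      norm_num

lemma kstChi_eq_zero (x : ℝ) (hx : 1 / 3 ≤ |x - round x|) : kstChi x = 0 := by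
  unfold kstChi
  have h1 : Real.cos (2 * Real.pi * x) = Real.cos (2 * Real.pi * |x - round x|) := by
    have e : 2 * Real.pi * |x - round x| = |2 * Real.pi * x - round x * (2 * Real.pi)| := by
      have : 2 * Real.pi * x - round x * (2 * Real.pi) = 2 * Real.pi * (x - round x) := by ring
      rw [this, abs_mul, abs_of_pos Real.two_pi_pos]
    rw [e, Real.cos_abs, Real.cos_sub_int_mul_two_pi]
  have h2 := abs_sub_round x
  have h3 : Real.cos (2 * Real.pi * |x - round x|) ≤ Real.cos (Real.pi - Real.pi / 3) := by
    apply Real.cos_le_cos_of_nonneg_of_le_pi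
    · have := Real.pi_pos
      linarith
    · have := Real.pi_pos
      nlinarith
    · have := Real.pi_pos
      nlinarith
  rw [Real.cos_pi_sub, Real.cos_pi_div_three] at h3
  rw [max_eq_left]
  refine (min_le_right _ _).trans ?_
  rw [h1]
  linarith

lemma kst_code (ι : Type) [Fintype ι] : ∃ t : ι → ℤ → ℤ,
    Function.Injective fun κ : ι → ℤ => ∑ j, t j (κ j) := by
  classical
  obtain ⟨enc, henc⟩ := exists_injective_nat (ι × ℤ)
  refine ⟨fun j k => ((2 ^ enc (j, k) : ℕ) : ℤ), ?_⟩
  intro κ κ' h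
  simp only at h
  have h1 : ∑ j, 2 ^ enc (j, κ j) = ∑ j, 2 ^ enc (j, κ' j) := by exact_mod_cast h
  have inj : ∀ κ : ι → ℤ, Function.Injective fun j => enc (j, κ j) := by
    intro κ i j hij
    exact (Prod.ext_iff.1 (henc hij)).1
  have e : ∀ κ : ι → ℤ, ∑ j, 2 ^ enc (j, κ j)
      = ∑ n ∈ Finset.univ.image (fun j => enc (j, κ j)), 2 ^ n := by
    intro κ
    rw [Finset.sum_image fun i _ j _ hij => inj κ hij]
  rw [e, e] at h1
  have h2 := Finset.geomSum_injective (le_refl 2) h1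
  funext j
  have h3 : enc (j, κ j) ∈ Finset.univ.image (fun j => enc (j, κ' j)) := by
    rw [← h2]
    exact Finset.mem_image_of_mem _ (Finset.mem_univ j)
  obtain ⟨i, -, hi⟩ := Finset.mem_image.1 h3
  have h4 := Prod.ext_iff.1 (henc hi)
  simp only at h4
  rw [← h4.2, h4.1]

lemma kst_mul_cont {Y : Type*} [TopologicalSpace Y] (P h : Y → ℝ) (hP : Continuous P) (C : ℝ)
    (hC : ∀ y, |h y| ≤ C) (hh : ∀ y, P y ≠ 0 → ContinuousAt h y) :
    Continuous fun y => P y * h y := by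
  rw [continuous_iff_continuousAt]
  intro y
  by_cases hy : P y = 0
  · have h1 : Tendsto (fun y => |P y| * C) (𝓝 y) (𝓝 0) := by
      have : Continuous fun y => |P y| * C := by fun_prop
      have := this.tendsto y
      simpa [hy] using this
    show Tendsto _ _ _
    simp only [hy, zero_mul]
    refine squeeze_zero_norm (fun z => ?_) h1
    rw [norm_mul, Real.norm_eq_abs, Real.norm_eq_abs]
    exact mul_le_mul_of_nonneg_left (hC z) (abs_nonneg _)
  · exact hP.continuousAt.mul (hh y hy)

/-- Recovering the position from the coordinates `(χ x, χ x * sin (π x))`. -/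
noncomputable def kstPos {ι : Type} (κ : ι → ℤ) (y : ι × Bool → ℝ) : ι → ℝ :=
  fun j => κ j + Real.arcsin (Real.cos (κ j * Real.pi) * y (j, true) / y (j, false)) / Real.pi

lemma kst_local_cont {ι : Type} [Fintype ι] (κ : ι → ℤ) (f : (ι → ℝ) → ℝ) (hf : Continuous f) :
    Continuous fun y : ι × Bool → ℝ => (∏ j, y (j, false)) * f (kstPos κ y) := by
  have hcomp : IsCompact (Set.pi Set.univ fun j => Set.Icc ((κ j : ℝ) - 1) (κ j + 1)) :=
    isCompact_univ_pi fun j => isCompact_Icc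
  obtain ⟨C, hC⟩ := hcomp.exists_bound_of_continuousOn hf.continuousOn
  refine kst_mul_cont _ _ (by fun_prop) C (fun y => hC _ ?_) ?_
  · intro j _
    unfold kstPos
    have h1 := Real.arcsin_le_pi_div_two
      (Real.cos (κ j * Real.pi) * y (j, true) / y (j, false))
    have h2 := Real.neg_pi_div_two_le_arcsin
      (Real.cos (κ j * Real.pi) * y (j, true) / y (j, false))
    have hp := Real.pi_pos
    have h3 : Real.arcsin (Real.cos (κ j * Real.pi) * y (j, true) / y (j, false)) / Real.pi ≤ 1 := by
      rw [div_le_iff₀ hp]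
      linarith
    have h4 : -1 ≤
        Real.arcsin (Real.cos (κ j * Real.pi) * y (j, true) / y (j, false)) / Real.pi := by
      rw [le_div_iff₀ hp]
      linarith
    constructor <;> linarith
  · intro y hy
    have hy' : ∀ j, y (j, false) ≠ 0 := fun j => (Finset.prod_ne_zero_iff.1 hy) j (Finset.mem_univ j)
    refine hf.continuousAt.comp ?_
    refine continuousAt_pi.2 fun j => ?_
    unfold kstPos
    refine continuousAt_const.add (ContinuousAt.div_const ?_ _)
    refine Real.continuous_arcsin.continuousAt.comp ?_
    refine ContinuousAt.div ?_ ?_ (hy' j)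
    · exact (by fun_prop : Continuous fun y : ι × Bool → ℝ =>
        Real.cos (κ j * Real.pi) * y (j, true)).continuousAt
    · exact (continuous_apply (j, false)).continuousAt

lemma kst_pos_eq (x : ℝ) (hχ : kstChi x ≠ 0) :
    (round x : ℝ) + Real.arcsin (Real.cos (round x * Real.pi) *
      (kstChi x * Real.sin (Real.pi * x)) / kstChi x) / Real.pi = x := by
  have hp := Real.pi_pos
  have h1 : |x - round x| < 1 / 3 := by
    by_contra h
    exact hχ (kstChi_eq_zero x (not_lt.1 h))
  have e1 : Real.cos (round x * Real.pi) * (kstChi x * Real.sin (Real.pi * x)) / kstChi x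
      = Real.sin (Real.pi * (x - round x)) := by
    have e2 : Real.pi * (x - round x) = Real.pi * x - round x * Real.pi := by ring
    rw [e2, Real.sin_sub, Real.sin_int_mul_pi]
    field_simp
    ring
  rw [abs_lt] at h1
  rw [e1, Real.arcsin_sin]
  · field_simp
    ring
  · nlinarith
  · nlinarith

/-- Local coordinates of the real line. -/
noncomputable def kstE (b : Bool) (x : ℝ) : ℝ :=
  if b then kstChi x * Real.sin (Real.pi * x) else kstChi x

lemma kstE_continuous (b : Bool) : Continuous (kstE b) := by
  have := kstChi_continuous
  unfold kstE
  cases b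
  · simpa using this
  · simp only [if_true]
    fun_prop

lemma kstE_mem (b : Bool) (x : ℝ) : kstE b x ∈ Set.Icc (-1 : ℝ) 1 := by
  have h0 := kstChi_nonneg x
  have h1 := kstChi_le_one x
  have h2 := Real.sin_le_one (Real.pi * x)
  have h3 := Real.neg_one_le_sin (Real.pi * x)
  unfold kstE
  cases b
  · simp only [Bool.false_eq_true, if_false]
    constructor <;> linarith
  · simp only [if_true]
    constructor <;> nlinarith

lemma kstE_zero (b : Bool) (x : ℝ) (hx : kstChi x = 0) : kstE b x = 0 := by
  unfold kstE
  cases b <;> simp [hx]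

/-- The sign attached to a subset of the index set. -/
noncomputable def kstSgn {ι : Type} [Fintype ι] (c : ι → Bool) : ℝ :=
  ∏ j, if c j then (1 : ℝ) else -1

lemma kstSgn_flip {ι : Type} [Fintype ι] [DecidableEq ι] (c : ι → Bool) (i : ι) :
    kstSgn (Function.update c i (!c i)) = - kstSgn c := by
  unfold kstSgn
  rw [← Finset.mul_prod_erase _ _ (Finset.mem_univ i),
    ← Finset.mul_prod_erase Finset.univ (fun j => if c j then (1 : ℝ) else -1) (Finset.mem_univ i)]
  have : ∏ x ∈ Finset.univ.erase i, (if Function.update c i (!c i) x then (1 : ℝ) else -1)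
      = ∏ x ∈ Finset.univ.erase i, (if c x then (1 : ℝ) else -1) := by
    refine Finset.prod_congr rfl fun j hj => ?_
    rw [Function.update_of_ne (Finset.ne_of_mem_erase hj)]
  rw [this]
  cases c i <;> simp

lemma kst_color (ι : Type) [Fintype ι] :
    ∃ (Q : Type) (_ : Fintype Q) (β : Q → ι → ℝ → ℝ), (∀ q j, Continuous (β q j)) ∧
      ∀ f : (ι → ℝ) → ℝ, Continuous f → ∃ G : Q → ℝ → ℝ, (∀ q, Continuous (G q)) ∧
        ∀ x : ι → ℝ, f x * ∏ j, kstChi (x j) = ∑ q, G q (∑ j, β q j (x j)) := by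
  classical
  obtain ⟨r, α, R, hR, hα, hαR, hrep⟩ := kst_cube (ι × Bool)
  obtain ⟨t, ht⟩ := kst_code ι
  set T : (ι → ℤ) → ℤ := fun κ => ∑ j, t j (κ j) with hT
  have hθ : ∀ j, ∃ θ : ℝ → ℝ, Continuous θ ∧
      ∀ (k : ℤ) (x : ℝ), |x - k| ≤ 1 / 3 → θ x = (t j k : ℝ) :=
    fun j => kst_glue (fun k _ => (t j k : ℝ)) fun k => continuous_const
  choose θ hθc hθ using hθ
  set L : ℝ := 3 * R + 3 with hL
  have hLp : 0 < L := by positivity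
  refine ⟨Fin r × (ι → Bool), inferInstance,
    fun q j x => L * θ j x + ∑ b, α q.1 (j, b) (if q.2 j then kstE b x else 0), ?_, ?_⟩
  · intro q j
    refine (continuous_const.mul (hθc j)).add (continuous_finsetSum _ fun b _ => ?_)
    cases q.2 j
    · simpa using continuous_const
    · exact (hα _ _).comp (kstE_continuous b)
  intro f hf
  have hg : ∀ κ : ι → ℤ, _ := fun κ => hrep _ (kst_local_cont κ f hf)
  choose g hgc hg using hg
  -- the outer functions
  set H : Fin r → ℤ → ℝ → ℝ := fun q k z =>
    Function.extend T (fun κ => g κ q) (fun _ _ => 0) k (L * (z - k)) with hH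
  have hHc : ∀ q k, Continuous (H q k) := by
    intro q k
    have : Continuous (Function.extend T (fun κ => g κ q) (fun _ _ => 0) k) := by
      by_cases hk : ∃ κ, T κ = k
      · obtain ⟨κ, rfl⟩ := hk
        rw [ht.extend_apply]
        exact hgc κ q
      · rw [Function.extend_apply' _ _ _ hk]
        exact continuous_const
    exact this.comp (by fun_prop)
  have hG : ∀ q, ∃ G : ℝ → ℝ, Continuous G ∧
      ∀ (k : ℤ) (x : ℝ), |x - k| ≤ 1 / 3 → G x = H q k x := fun q => kst_glue (H q) (hHc q)
  choose G hGc hG using hG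
  have hGval : ∀ q κ u, |u| ≤ R → G q ((L * T κ + u) / L) = g κ q u := by
    intro q κ u hu
    have e : (L * T κ + u) / L - (T κ : ℝ) = u / L := by
      field_simp
      ring
    rw [hG q (T κ)]
    · simp only [hH]
      rw [ht.extend_apply, e]
      congr 1
      field_simp
    · rw [e, abs_div, abs_of_pos hLp, div_le_iff₀ hLp, hL]
      linarith
  refine ⟨fun q z => kstSgn q.2 * G q.1 (z / L), ?_, ?_⟩
  · intro q
    exact continuous_const.mul ((hGc q.1).comp (by fun_prop))
  intro x
  rw [Fintype.sum_prod_type_right]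
  simp only
  by_cases hx : ∀ j, |x j - round (x j)| ≤ 1 / 3
  · set κ : ι → ℤ := fun j => round (x j) with hκ
    have hval : ∀ c : ι → Bool, ∑ q : Fin r, kstSgn c * G q ((∑ j, (L * θ j (x j) +
        ∑ b, α q (j, b) (if c j then kstE b (x j) else 0))) / L)
        = kstSgn c * ((∏ j, if c j then kstChi (x j) else 0) *
          f (kstPos κ fun i => if c i.1 then kstE i.2 (x i.1) else 0)) := by
      intro c
      rw [← Finset.mul_sum]
      congr 1
      have h1 := hg κ (fun i => if c i.1 then kstE i.2 (x i.1) else 0) (by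
        intro i
        by_cases hc : c i.1
        · simp only [hc, if_true]
          exact kstE_mem _ _
        · simp [hc])
      have h2 : ∀ j, (if c j then kstE false (x j) else 0) = if c j then kstChi (x j) else 0 := by
        intro j
        simp [kstE]
      simp only [h2] at h1
      rw [h1]
      refine Finset.sum_congr rfl fun q _ => ?_
      rw [← hGval q κ _ (hαR q _)]
      congr 2
      rw [Finset.sum_add_distrib, Fintype.sum_prod_type]
      congr 1
      simp only [hT]
      push_cast
      rw [Finset.mul_sum]
      refine Finset.sum_congr rfl fun j _ => ?_
      rw [hθ j _ _ (hx j)]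
    simp only [hval]
    rw [Finset.sum_eq_single (fun _ => true)]
    · simp only [if_true, kstSgn, Finset.prod_const_one, one_mul]
      by_cases hχ : ∀ j, kstChi (x j) ≠ 0
      · rw [mul_comm]
        congr 2
        funext j
        unfold kstPos kstE
        simp only [if_true, Bool.false_eq_true, if_false]
        exact (kst_pos_eq (x j) (hχ j)).symm
      · push Not at hχ
        obtain ⟨j, hj⟩ := hχ
        rw [Finset.prod_eq_zero (Finset.mem_univ j) hj]
        ring
    · intro c _ hc
      have : ∃ j, c j = false := by
        by_contra hcon
        push Not at hcon
        exact hc (funext fun j => by simpa using hcon j)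
      obtain ⟨j, hj⟩ := this
      rw [Finset.prod_eq_zero (Finset.mem_univ j) (by simp [hj])]
      ring
    · intro h
      exact absurd (Finset.mem_univ _) h
  · push Not at hx
    obtain ⟨i, hi⟩ := hx
    have hχ : kstChi (x i) = 0 := kstChi_eq_zero _ hi.le
    rw [Finset.prod_eq_zero (Finset.mem_univ i) hχ, mul_zero]
    symm
    refine Finset.sum_involution (fun c _ => Function.update c i (!c i)) ?_ ?_ ?_ ?_
    · intro c _
      rw [← Finset.sum_add_distrib]
      refine Finset.sum_eq_zero fun q _ => ?_
      rw [kstSgn_flip]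
      have : ∀ j, ∑ b, α q (j, b) (if Function.update c i (!c i) j then kstE b (x j) else 0)
          = ∑ b, α q (j, b) (if c j then kstE b (x j) else 0) := by
        intro j
        refine Finset.sum_congr rfl fun b _ => ?_
        by_cases hj : j = i
        · subst hj
          simp [kstE_zero _ _ hχ]
        · rw [Function.update_of_ne hj]
      simp only [this]
      ring
    · intro c _ _ h
      have := congrFun h i
      simp at this
    · intro c _
      exact Finset.mem_univ _
    · intro c _
      simp

lemma kst_real (ι : Type) [Fintype ι] :
    ∃ (Q : Type) (_ : Fintype Q) (β : Q → ι → ℝ → ℝ), (∀ q j, Continuous (β q j)) ∧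
      ∀ f : (ι → ℝ) → ℝ, Continuous f → ∃ G : Q → ℝ → ℝ, (∀ q, Continuous (G q)) ∧
        ∀ x : ι → ℝ, f x = ∑ q, G q (∑ j, β q j (x j)) := by
  classical
  obtain ⟨Q, hQ, β, hβ, hrep⟩ := kst_color ι
  set s : Bool → ℝ := fun b => if b then 1 / 2 else 0 with hs
  refine ⟨(ι → Bool) × Q, inferInstance, fun q j x => β q.2 j (x - s (q.1 j)), ?_, ?_⟩
  · intro q j
    exact (hβ _ _).comp (by fun_prop)
  intro f hf
  have h : ∀ c : ι → Bool, _ := fun c => hrep (fun x => f fun j => x j + s (c j)) (by fun_prop)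
  choose G hGc hG using h
  refine ⟨fun q => G q.1 q.2, fun q => hGc _ _, ?_⟩
  intro x
  rw [Fintype.sum_prod_type]
  have h1 : ∀ c : ι → Bool, ∑ q, G c q (∑ j, β q j (x j - s (c j)))
      = f x * ∏ j, kstChi (x j - s (c j)) := by
    intro c
    rw [← hG c (fun j => x j - s (c j))]
    simp
  simp only [h1]
  rw [← Finset.mul_sum]
  have h2 : ∏ j, ∑ b : Bool, kstChi (x j - s b) = ∑ c : ι → Bool, ∏ j, kstChi (x j - s (c j)) :=
    Fintype.prod_sum fun j b => kstChi (x j - s b)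
  rw [← h2]
  have h3 : ∀ j, ∑ b : Bool, kstChi (x j - s b) = 1 := by
    intro j
    rw [Fintype.sum_bool]
    simp only [hs, if_true, Bool.false_eq_true, if_false, sub_zero]
    rw [add_comm]
    exact kstChi_add _
  rw [Finset.prod_congr rfl fun j _ => h3 j, Finset.prod_const_one, mul_one]

/-- For a space `X` homeomorphic to a closed subspace of some Euclidean space,
and every `m, n ≥ 1`, there is `r` and continuous `ψ p q : X → ℝ^n` such that
every continuous `f : X^m → ℝ^n` is `f x = ∑ q, g q (∑ p, ψ p q (x p))`
for continuous `g q : ℝ^n → ℝ^n`. -/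
theorem superposition_vector_valued_of_closed_in_euclidean
    (X : Type*) [TopologicalSpace X]
    (hX : ∃ (ℓ : ℕ) (s : Set (Fin ℓ → ℝ)), IsClosed s ∧ Nonempty (X ≃ₜ s))
    (m n : ℕ) (hm : 1 ≤ m) (hn : 1 ≤ n) :
    ∃ (r : ℕ) (ψ : Fin m → Fin r → X → (Fin n → ℝ)),
      (∀ p q, Continuous (ψ p q)) ∧
      ∀ f : (Fin m → X) → (Fin n → ℝ), Continuous f →
        ∃ g : Fin r → (Fin n → ℝ) → (Fin n → ℝ),
          (∀ q, Continuous (g q)) ∧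
          ∀ x : Fin m → X,
            f x = ∑ q : Fin r, g q (∑ p : Fin m, ψ p q (x p)) := by
  obtain ⟨ℓ, s, hs, ⟨e⟩⟩ := hX
  obtain ⟨Q, hQ, β, hβ, hrep⟩ := kst_real (Fin m × Fin ℓ)
  let eq : Q ≃ Fin (Fintype.card Q) := Fintype.equivFin Q
  set E : X → Fin ℓ → ℝ := fun x => (e x : Fin ℓ → ℝ) with hE
  have hEc : Topology.IsClosedEmbedding E :=
    hs.isClosedEmbedding_subtypeVal.comp e.isClosedEmbedding
  set J : (Fin m → X) → (Fin m × Fin ℓ → ℝ) := fun x i => E (x i.1) i.2 with hJ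
  have hJc : Topology.IsClosedEmbedding J := by
    have h1 : Topology.IsClosedEmbedding (fun (x : Fin m → X) (p : Fin m) => E (x p)) := by
      refine ⟨Topology.IsEmbedding.piMap fun _ => hEc.isEmbedding, ?_⟩
      have : Set.range (fun (x : Fin m → X) (p : Fin m) => E (x p))
          = Set.pi Set.univ fun _ => Set.range E := Set.range_piMap fun _ => E
      rw [this]
      exact isClosed_set_pi fun _ _ => hEc.isClosed_range
    have h2 : Topology.IsClosedEmbedding
        (fun (y : Fin m → Fin ℓ → ℝ) (i : Fin m × Fin ℓ) => y i.1 i.2) := by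
      refine (Homeomorph.isClosedEmbedding (
        { toFun := fun y i => y i.1 i.2
          invFun := fun z p i => z (p, i)
          left_inv := fun y => rfl
          right_inv := fun z => rfl
          continuous_toFun := by fun_prop
          continuous_invFun := by fun_prop } : (Fin m → Fin ℓ → ℝ) ≃ₜ (Fin m × Fin ℓ → ℝ)))
    exact h2.comp h1
  have hEcont : Continuous E := hEc.continuous
  refine ⟨Fintype.card Q, fun p q x _ => ∑ i, β (eq.symm q) (p, i) (E x i), ?_, ?_⟩
  · intro p q
    refine continuous_pi fun _ => continuous_finsetSum _ fun i _ => ?_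
    exact (hβ _ _).comp ((continuous_apply i).comp hEcont)
  intro f hf
  have hext : ∀ a : Fin n, ∃ F : C(Fin m × Fin ℓ → ℝ, ℝ), ∀ x, F (J x) = f x a := by
    intro a
    obtain ⟨F, hF⟩ := ContinuousMap.exists_extension' hJc
      (⟨fun x => f x a, (continuous_apply a).comp hf⟩ : C(Fin m → X, ℝ))
    exact ⟨F, fun x => congrFun hF x⟩
  choose F hF using hext
  have hG : ∀ a : Fin n, _ := fun a => hrep (F a) (F a).continuous
  choose G hGc hG using hG
  refine ⟨fun q y a => G a (eq.symm q) (y ⟨0, hn⟩), ?_, ?_⟩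
  · intro q
    exact continuous_pi fun a => (hGc a _).comp (continuous_apply _)
  intro x
  funext a
  rw [← hF a x, hG a (J x), Finset.sum_apply]
  rw [← Equiv.sum_comp eq]
  refine Finset.sum_congr rfl fun q _ => ?_
  simp only
  rw [Equiv.symm_apply_apply, Finset.sum_apply, Fintype.sum_prod_type]
end

section
/- Let X be a Tychonoff (completely regular Hausdorff) topological space. Then the following are equivalent: (1) some finite power X^k of X has a finite basic family; (2) X is homeomorphic to a closed subspace of some Euclidean space ℝ^ℓ. -/
open Set Filter Topology BoundedContinuousFunction

namespace KolmAux

/-- One colour class: a locally constant index function on a closed set. -/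
lemma one_colour {K : Type*} [MetricSpace K] [CompactSpace K] {I : Type*} [Countable I]
    [TopologicalSpace I] [DiscreteTopology I] (S : Set K) (hS : IsClosed S) (c : K → I)
    (hc : ContinuousOn c S) (f ψ : C(K, ℝ)) (ε δ : ℝ) (hε : 0 < ε)
    (hψ : ∀ x ∈ S, ∀ y ∈ S, c x = c y → |ψ x - ψ y| ≤ ε)
    (hf : ∀ x ∈ S, ∀ y ∈ S, c x = c y → |f x - f y| ≤ δ) :
    ∃ φ : C(K, ℝ), ‖φ - ψ‖ ≤ 2 * ε ∧ ∃ g : ℝ →ᵇ ℝ, ‖g‖ ≤ ‖f‖ ∧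
      ∀ x ∈ S, |f x - g (φ x)| ≤ δ := by
  have h1 : ∀ i : I, ∃ p : ℝ × ℝ, |p.2| ≤ ‖f‖ ∧
      ∀ x ∈ S, c x = i → |p.1 - ψ x| ≤ ε ∧ |f x - p.2| ≤ δ := by
    intro i
    by_cases h : ∃ x ∈ S, c x = i
    · obtain ⟨x, hx, rfl⟩ := h
      refine ⟨(ψ x, f x), f.norm_coe_le_norm x, fun y hy hyx => ⟨hψ x hx y hy hyx.symm, ?_⟩⟩
      exact hf y hy x hx hyx
    · refine ⟨(0, 0), by simp, fun x hx hxi => (h ⟨x, hx, hxi⟩).elim⟩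
  choose p hp1 hp2 using h1
  obtain ⟨enc, henc⟩ := exists_injective_nat I
  -- injective perturbation
  obtain ⟨v, hvinj, hv⟩ : ∃ v : I → ℝ, Function.Injective v ∧ ∀ i, |v i - (p i).1| ≤ ε := by
    have hfr : ∀ i, (0:ℝ) < 1 / ((enc i : ℝ) + 2) ∧ 1 / ((enc i : ℝ) + 2) < 1 := by
      intro i
      refine ⟨by positivity, ?_⟩
      rw [div_lt_one (by positivity)]
      have : (0:ℝ) ≤ enc i := by positivity
      linarith
    refine ⟨fun i => ε * (⌊(p i).1 / ε⌋ + 1 / ((enc i : ℝ) + 2)), ?_, ?_⟩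
    · intro i j hij
      have h2 := mul_left_cancel₀ hε.ne' hij
      have hfl : ⌊(⌊(p i).1 / ε⌋ : ℝ) + 1 / ((enc i : ℝ) + 2)⌋ = ⌊(p i).1 / ε⌋ := by
        rw [Int.floor_eq_iff]
        have := hfr i
        constructor <;> linarith
      have hfl' : ⌊(⌊(p j).1 / ε⌋ : ℝ) + 1 / ((enc j : ℝ) + 2)⌋ = ⌊(p j).1 / ε⌋ := by
        rw [Int.floor_eq_iff]
        have := hfr j
        constructor <;> linarith
      have h3 : ⌊(p i).1 / ε⌋ = ⌊(p j).1 / ε⌋ := by rw [← hfl, ← hfl', h2]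
      rw [h3] at h2
      have h4 := add_left_cancel h2
      rw [one_div, one_div, inv_inj] at h4
      apply henc
      have h5 : (enc i : ℝ) = enc j := by linarith
      exact_mod_cast h5
    · intro i
      have h2 : (p i).1 = ε * ((p i).1 / ε) := by field_simp
      have h3 := hfr i
      have h4 := Int.floor_le ((p i).1 / ε)
      have h5 := Int.lt_floor_add_one ((p i).1 / ε)
      have : ε * (⌊(p i).1 / ε⌋ + 1 / ((enc i : ℝ) + 2)) - (p i).1
          = ε * (⌊(p i).1 / ε⌋ + 1 / ((enc i : ℝ) + 2) - (p i).1 / ε) := by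
        rw [mul_sub, ← h2]
      show |ε * (⌊(p i).1 / ε⌋ + 1 / ((enc i : ℝ) + 2)) - (p i).1| ≤ ε
      rw [this, abs_mul, abs_of_pos hε]
      have : |(⌊(p i).1 / ε⌋ + 1 / ((enc i : ℝ) + 2) - (p i).1 / ε)| ≤ 1 := by
        rw [abs_le]; constructor <;> linarith
      nlinarith
  -- the function φ
  have hcont : Continuous (fun x : S => v (c x) - ψ x) := by
    have h1 : Continuous (fun x : S => c x) := continuousOn_iff_continuous_domRestrict.1 hc
    exact (continuous_of_discreteTopology.comp h1).sub (ψ.continuous.comp continuous_subtype_val)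
  obtain ⟨η, hη1, hη2⟩ := ContinuousMap.exists_restrict_eq_forall_mem_of_closed
    (⟨_, hcont⟩ : C(S, ℝ)) (t := Icc (-(2*ε)) (2*ε)) (by
      rintro ⟨x, hx⟩
      have h1 := hv (c x)
      have h2 := (hp2 (c x) x hx rfl).1
      rw [abs_le] at h1 h2
      constructor <;> simp only [ContinuousMap.coe_mk] <;> linarith)
      ⟨0, by constructor <;> linarith⟩ hS
  have hη3 : ∀ x ∈ S, (ψ + η) x = v (c x) := by
    intro x hx
    have := DFunLike.congr_fun hη2 ⟨x, hx⟩
    simp only [ContinuousMap.restrict_apply, ContinuousMap.coe_mk] at this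
    simp [this]
  -- the function g
  have hT : (c '' S).Finite := (hS.isCompact.image_of_continuousOn hc).finite_of_discrete
  have hF : (v '' (c '' S)).Finite := hT.image v
  have h2 : ∀ y : ℝ, ∃ r : ℝ, |r| ≤ ‖f‖ ∧ ∀ i, v i = y → r = (p i).2 := by
    intro y
    by_cases h : ∃ i, v i = y
    · obtain ⟨i, rfl⟩ := h
      exact ⟨(p i).2, hp1 i, fun j hj => by rw [hvinj hj]⟩
    · exact ⟨0, by simp, fun i hi => (h ⟨i, hi⟩).elim⟩
  choose u hu1 hu2 using h2
  have : Finite (v '' (c '' S)) := hF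
  obtain ⟨g, hg1, hg2⟩ := ContinuousMap.exists_restrict_eq_forall_mem_of_closed
    (⟨fun y => u y, continuous_of_discreteTopology⟩ : C((v '' (c '' S) : Set ℝ), ℝ))
      (t := Icc (-‖f‖) (‖f‖)) (fun y => abs_le.1 (hu1 y))
      ⟨0, by constructor <;> simp⟩ hF.isClosed
  refine ⟨ψ + η, ?_, BoundedContinuousFunction.ofNormedAddCommGroup g g.continuous ‖f‖
    (fun y => abs_le.2 (hg1 y)), ?_, ?_⟩
  · rw [add_sub_cancel_left, ContinuousMap.norm_le _ (by positivity)]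
    intro x
    exact abs_le.2 (hη1 x)
  · exact BoundedContinuousFunction.norm_ofNormedAddCommGroup_le _ (norm_nonneg _) _
  · intro x hx
    rw [hη3 x hx]
    have h3 := DFunLike.congr_fun hg2 ⟨v (c x), mem_image_of_mem _ (mem_image_of_mem _ hx)⟩
    simp only [ContinuousMap.restrict_apply, ContinuousMap.coe_mk] at h3
    show |f x - g (v (c x))| ≤ δ
    rw [h3, hu2 _ (c x) rfl]
    exact (hp2 (c x) x hx rfl).2

/-- coordinates good for colour `q` -/
def good (N : ℕ) (n : ℕ) (q : ℕ) : Set ℝ :=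
  {t | ∀ z : ℤ, 1 / (2 * N : ℝ) ≤ |n * t - q / N - z|}

lemma good_closed (N n q : ℕ) : IsClosed (good N n q) := by
  have : good N n q = ⋂ z : ℤ, {t : ℝ | 1 / (2 * N : ℝ) ≤ |n * t - q / N - z|} := by
    ext; simp [good]
  rw [this]
  exact isClosed_iInter fun z => isClosed_le continuous_const (by fun_prop)

lemma bad_unique (N n : ℕ) (t : ℝ) (q q' : Fin N) (h : t ∉ good N n q) (h' : t ∉ good N n q') :
    q = q' := by
  simp only [good, mem_ofPred_eq, not_forall, not_le] at h h'
  obtain ⟨z, hz⟩ := h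
  obtain ⟨z', hz'⟩ := h'
  have hN : (0:ℝ) < N := by exact_mod_cast (Nat.zero_le _).trans_lt q.2
  rw [abs_lt] at hz hz'
  have e1 : 1 / (2 * N : ℝ) + 1 / (2 * N : ℝ) = 1 / N := by field_simp; norm_num
  have h1 : |((q:ℝ) / N - q' / N) + (z - z')| < 1 / N := by
    rw [abs_lt]; constructor <;> linarith [hz.1, hz.2, hz'.1, hz'.2]
  have h2 : |(q:ℝ) - q' + N * (z - z')| < 1 := by
    have : (q:ℝ) - q' + N * (z - z') = N * (((q:ℝ) / N - q' / N) + (z - z')) := by field_simp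
    rw [this, abs_mul, abs_of_pos hN]
    calc N * |((q:ℝ) / N - q' / N) + (z - z')| < N * (1 / N) := by gcongr
      _ = 1 := by field_simp
  have h3 : |((q:ℕ):ℤ) - (q':ℕ) + N * (z - z')| < 1 := by exact_mod_cast h2
  rw [Int.abs_lt_one_iff] at h3
  have h4 := q.2
  have h5 := q'.2
  have h6 : z - z' = 0 := by
    by_contra hne
    rcases lt_or_gt_of_ne hne with hlt | hgt
    · have : (N:ℤ) * (z - z') ≤ N * (-1) := by
        apply mul_le_mul_of_nonneg_left <;> omega
      omega
    · have : (N:ℤ) * 1 ≤ N * (z - z') := by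
        apply mul_le_mul_of_nonneg_left <;> omega
      omega
  rw [h6] at h3
  apply Fin.ext
  omega

lemma floor_cont (N n q : ℕ) (hN : 0 < N) :
    ContinuousOn (fun t : ℝ => ⌊n * t - q / N⌋) (good N n q) := by
  intro t ht
  apply ContinuousAt.continuousWithinAt
  have hN' : (0:ℝ) < 1 / (2 * N : ℝ) := by positivity
  have h1 := ht ⌊n * t - (q:ℝ) / N⌋
  have h2 : (⌊n * t - (q:ℝ) / N⌋ : ℝ) < n * t - q / N := by
    rcases (Int.floor_le (n * t - (q:ℝ) / N)).lt_or_eq with h | h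
    · exact h
    · rw [h, sub_self, abs_zero] at h1; linarith
  have h3 := Int.lt_floor_add_one (n * t - (q:ℝ) / N)
  have hc : Continuous (fun s : ℝ => n * s - (q:ℝ) / N) := by fun_prop
  have h4 : ∀ᶠ s in 𝓝 t, ⌊n * s - (q:ℝ) / N⌋ = ⌊n * t - (q:ℝ) / N⌋ := by
    filter_upwards [hc.continuousAt.eventually (Ioo_mem_nhds h2 h3)] with s hs
    rw [Int.floor_eq_iff]
    exact ⟨hs.1.le, hs.2⟩
  exact (continuousAt_const (y := ⌊n * t - (q:ℝ) / N⌋)).congr (h4.mono fun s hs => hs.symm)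

open Classical in
lemma bad_card (m N n : ℕ) (x : Fin m → ℝ) :
    (Finset.univ.filter fun q : Fin N => ¬ ∀ i, x i ∈ good N n q).card ≤ m := by
  classical
  have : (Finset.univ.filter fun q : Fin N => ¬ ∀ i, x i ∈ good N n q) ⊆
      Finset.univ.biUnion fun i : Fin m =>
        Finset.univ.filter fun q : Fin N => x i ∉ good N n q := by
    intro q hq
    simpa using hq
  refine (Finset.card_le_card this).trans (Finset.card_biUnion_le.trans ?_)
  calc ∑ i : Fin m, (Finset.univ.filter fun q : Fin N => x i ∉ good N n q).card
      ≤ ∑ i : Fin m, 1 := by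
        apply Finset.sum_le_sum
        intro i _
        rw [Finset.card_le_one]
        intro a ha b hb
        simp only [Finset.mem_filter, Finset.mem_univ, true_and] at ha hb
        exact bad_unique N n _ a b ha hb
    _ = m := by simp

lemma approx (m N : ℕ) (hN : N = 4 * (m + 1)) (K : Set (Fin m → ℝ)) [CompactSpace K] (f : C(K, ℝ)) (hf0 : f ≠ 0)
    (ψ : Fin N → C(K, ℝ)) (ε : ℝ) (hε : 0 < ε) :
    ∃ φ : Fin N → C(K, ℝ), (∀ q, ‖φ q - ψ q‖ ≤ ε) ∧
      ∃ g : Fin N → (ℝ →ᵇ ℝ), (∀ q, ‖g q‖ ≤ ‖f‖) ∧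
        ‖f - ∑ q, (g q).toContinuousMap.comp (φ q)‖ ≤ 3 / 4 * ‖f‖ := by
  classical
  have hN0 : 0 < N := by omega
  have hNr : (0:ℝ) < N := by exact_mod_cast hN0
  have hf : 0 < ‖f‖ := norm_pos_iff.2 hf0
  have huc : UniformContinuous (fun x : K => (f x, fun q => ψ q x)) :=
    CompactSpace.uniformContinuous_of_continuous (by fun_prop)
  obtain ⟨δ, hδ, hd⟩ := Metric.uniformContinuous_iff.1 huc (min (ε / 2) (‖f‖ / 4))
    (by positivity)
  obtain ⟨n, hn⟩ := exists_nat_one_div_lt hδ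
  set M := n + 1 with hM
  have hMr : (0:ℝ) < M := by positivity
  have key : ∀ q : Fin N, ∃ φ : C(K, ℝ), ‖φ - ψ q‖ ≤ 2 * (ε / 2) ∧ ∃ g : ℝ →ᵇ ℝ, ‖g‖ ≤ ‖f‖ ∧
      ∀ x ∈ {x : K | ∀ i, x.1 i ∈ good N M q}, |f x - g (φ x)| ≤ ‖f‖ / 4 := by
    intro q
    have hclose : ∀ x ∈ {x : K | ∀ i, x.1 i ∈ good N M q}, ∀ y ∈ {x : K | ∀ i, x.1 i ∈ good N M q},
        (fun i => ⌊M * x.1 i - (q:ℕ) / N⌋) = (fun i => ⌊M * y.1 i - (q:ℕ) / N⌋) →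
        dist x y < δ := by
      intro x _ y _ hxy
      refine lt_of_le_of_lt ?_ hn
      rw [Subtype.dist_eq, dist_pi_le_iff (by positivity)]
      intro i
      have h1 := Int.abs_sub_lt_one_of_floor_eq_floor (congrFun hxy i)
      have h2 : (M * x.1 i - ((q:ℕ):ℝ) / N) - (M * y.1 i - ((q:ℕ):ℝ) / N)
        = M * (x.1 i - y.1 i) := by ring
      rw [h2, abs_mul, abs_of_pos hMr] at h1
      rw [Real.dist_eq, le_div_iff₀ (by positivity)]
      have : (M:ℝ) = n + 1 := by simp [hM]
      rw [← this]
      linarith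
    refine one_colour _ ?_ (fun x : K => fun i => ⌊M * x.1 i - (q:ℕ) / N⌋) ?_ f (ψ q) (ε / 2)
      (‖f‖ / 4) (by positivity) ?_ ?_
    · have : {x : K | ∀ i, x.1 i ∈ good N M q} = ⋂ i, (fun x : K => x.1 i) ⁻¹' good N M q := by
        ext; simp
      rw [this]
      exact isClosed_iInter fun i => (good_closed N M q).preimage
        ((continuous_apply i).comp continuous_subtype_val)
    · apply continuousOn_pi.2
      intro i
      exact (floor_cont N M q hN0).comp (f := fun x : K => x.1 i)
        ((continuous_apply i).comp continuous_subtype_val).continuousOn (fun x hx => hx i)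
    · intro x hx y hy hxy
      have h1 := hd (hclose x hx y hy hxy)
      rw [Prod.dist_eq, max_lt_iff] at h1
      have h2 := (dist_le_pi_dist (fun q => ψ q x) (fun q => ψ q y) q).trans_lt h1.2
      exact (h2.trans_le (min_le_left _ _)).le
    · intro x hx y hy hxy
      have h1 := hd (hclose x hx y hy hxy)
      rw [Prod.dist_eq, max_lt_iff] at h1
      exact (h1.1.trans_le (min_le_right _ _)).le
  choose φ hφ g hg hfg using key
  refine ⟨φ, fun q => by simpa [mul_div_cancel₀] using hφ q, fun q => (1 / N : ℝ) • g q, ?_, ?_⟩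
  · intro q
    rw [norm_smul, Real.norm_of_nonneg (by positivity)]
    have : (1 / N : ℝ) ≤ 1 := by
      rw [div_le_one hNr]; exact_mod_cast hN0
    calc (1 / N : ℝ) * ‖g q‖ ≤ 1 * ‖g q‖ := by gcongr
      _ ≤ ‖f‖ := by rw [one_mul]; exact hg q
  · rw [ContinuousMap.norm_le _ (by positivity)]
    intro x
    have e1 : (f - ∑ q, ((1 / N : ℝ) • g q).toContinuousMap.comp (φ q)) x
        = ∑ q, (1 / N : ℝ) * (f x - g q (φ q x)) := by
      simp only [ContinuousMap.sub_apply, ContinuousMap.sum_apply, ContinuousMap.comp_apply]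
      rw [← Finset.mul_sum, Finset.sum_sub_distrib, mul_sub, Finset.mul_sum, Finset.mul_sum]
      congr 1
      simp
      field_simp
    rw [e1, ← Finset.mul_sum, norm_mul, Real.norm_of_nonneg (by positivity)]
    have e2 : ‖∑ q, (f x - g q (φ q x))‖ ≤ ∑ q : Fin N, (‖f‖ / 4 +
        if ¬ ∀ i, x.1 i ∈ good N M q then 2 * ‖f‖ else 0) := by
      refine (norm_sum_le _ _).trans (Finset.sum_le_sum fun q _ => ?_)
      split_ifs with h
      · have := hfg q x h
        rw [Real.norm_eq_abs]
        linarith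
      · have h1 := f.norm_coe_le_norm x
        have h2 := (g q).norm_coe_le_norm (φ q x)
        have h3 := norm_sub_le (f x) (g q (φ q x))
        have h4 := hg q
        linarith
    have e3 : ∑ q : Fin N, (‖f‖ / 4 +
        if ¬ ∀ i, x.1 i ∈ good N M q then 2 * ‖f‖ else 0) ≤ N * (‖f‖ / 4) + m * (2 * ‖f‖) := by
      rw [Finset.sum_add_distrib, Finset.sum_const, ← Finset.sum_filter, Finset.sum_const]
      simp only [Finset.card_univ, Fintype.card_fin, nsmul_eq_mul]
      gcongr
      exact bad_card m N M x.1
    have e4 : (N : ℝ) = 4 * (m + 1) := by rw [hN]; push_cast; ring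
    calc (1 / N : ℝ) * ‖∑ q, (f x - g q (φ q x))‖
        ≤ (1 / N : ℝ) * (N * (‖f‖ / 4) + m * (2 * ‖f‖)) := by gcongr; exact e2.trans e3
      _ ≤ 3 / 4 * ‖f‖ := by
        rw [one_div, inv_mul_le_iff₀ hNr, e4]
        nlinarith

end KolmAux

namespace KolmAux

lemma surj_of_approx {E F : Type*} [NormedAddCommGroup E] [NormedSpace ℝ E] [CompleteSpace E]
    [NormedAddCommGroup F] [NormedSpace ℝ F] (T : E →L[ℝ] F) (C θ : ℝ)
    (hθ0 : 0 ≤ θ) (hθ : θ < 1) (hC : 0 ≤ C)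
    (h : ∀ y, ∃ x, ‖x‖ ≤ C * ‖y‖ ∧ ‖y - T x‖ ≤ θ * ‖y‖) : Function.Surjective T := by
  intro y
  choose s hs1 hs2 using h
  let r : ℕ → F := fun n => Nat.rec y (fun _ z => z - T (s z)) n
  have hr : ∀ n, r (n + 1) = r n - T (s (r n)) := fun n => rfl
  have hr0 : r 0 = y := rfl
  have hrn : ∀ n, ‖r n‖ ≤ θ ^ n * ‖y‖ := by
    intro n
    induction n with
    | zero => simp [hr0]
    | succ n ih =>
      rw [hr, pow_succ']
      refine (hs2 _).trans ?_
      rw [mul_assoc]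
      gcongr
  have hsum : Summable (fun n => s (r n)) := by
    refine Summable.of_norm_bounded (g := fun n => θ ^ n * (C * ‖y‖))
      ((summable_geometric_of_lt_one hθ0 hθ).mul_right _) fun n => ?_
    refine (hs1 _).trans ?_
    calc C * ‖r n‖ ≤ C * (θ ^ n * ‖y‖) := by gcongr; exact hrn n
      _ = _ := by ring
  refine ⟨∑' n, s (r n), ?_⟩
  have h1 : Tendsto (fun n => ∑ i ∈ Finset.range n, T (s (r i))) atTop (𝓝 (T (∑' n, s (r n)))) :=
    (T.hasSum hsum.hasSum).tendsto_sum_nat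
  have h2 : ∀ n, ∑ i ∈ Finset.range n, T (s (r i)) = y - r n := by
    intro n
    induction n with
    | zero => simp [hr0]
    | succ n ih => rw [Finset.sum_range_succ, ih, hr]; abel
  have h3 : Tendsto r atTop (𝓝 0) := by
    apply squeeze_zero_norm hrn
    simpa using (tendsto_pow_atTop_nhds_zero_of_lt_one hθ0 hθ).mul_const ‖y‖
  have h4 : Tendsto (fun n => ∑ i ∈ Finset.range n, T (s (r i))) atTop (𝓝 y) := by
    simp only [h2]
    simpa using tendsto_const_nhds.sub h3
  exact tendsto_nhds_unique h1 h4

noncomputable def superpos {N : ℕ} {K : Type*} [TopologicalSpace K] [CompactSpace K]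
    (φ : Fin N → C(K, ℝ)) : (Fin N → (ℝ →ᵇ ℝ)) →L[ℝ] C(K, ℝ) :=
  LinearMap.mkContinuous
    { toFun := fun g => ∑ q, (g q).toContinuousMap.comp (φ q)
      map_add' := by
        intro a b
        ext x
        simp [ContinuousMap.sum_apply, Finset.sum_add_distrib]
      map_smul' := by
        intro a b
        ext x
        simp [ContinuousMap.sum_apply, Finset.mul_sum] } N (by
    intro g
    rw [ContinuousMap.norm_le _ (by positivity)]
    intro x
    simp only [LinearMap.coe_mk, AddHom.coe_mk, ContinuousMap.sum_apply, ContinuousMap.comp_apply]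
    refine (norm_sum_le _ _).trans ?_
    calc ∑ q, ‖(g q).toContinuousMap (φ q x)‖ ≤ ∑ q : Fin N, ‖g‖ := by
          apply Finset.sum_le_sum
          intro q _
          exact ((g q).norm_coe_le_norm _).trans (norm_le_pi_norm g q)
      _ = N * ‖g‖ := by simp)

lemma superpos_apply {N : ℕ} {K : Type*} [TopologicalSpace K] [CompactSpace K]
    (φ : Fin N → C(K, ℝ)) (g : Fin N → (ℝ →ᵇ ℝ)) :
    superpos φ g = ∑ q, (g q).toContinuousMap.comp (φ q) := rfl

lemma compact_surj (m N : ℕ) (hN : N = 4 * (m + 1)) (K : Set (Fin m → ℝ)) [CompactSpace K] :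
    ∃ φ : Fin N → C(K, ℝ), Function.Surjective (superpos φ) := by
  let D : Set (C(K, ℝ)) := TopologicalSpace.denseSeq (C(K, ℝ)) |> range
  have hD : Dense D := TopologicalSpace.denseRange_denseSeq _
  have hDc : (D \ {0}).Countable := (countable_range _).mono sdiff_subset
  let O : C(K, ℝ) → Set (Fin N → C(K, ℝ)) := fun f =>
    {φ | ∃ g : Fin N → (ℝ →ᵇ ℝ), (∀ q, ‖g q‖ ≤ ‖f‖) ∧
      ‖f - ∑ q, (g q).toContinuousMap.comp (φ q)‖ < 7 / 8 * ‖f‖}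
  have hO : ∀ f ∈ D \ {0}, IsOpen (O f) := by
    intro f _
    have : O f = ⋃ g : {g : Fin N → (ℝ →ᵇ ℝ) // ∀ q, ‖g q‖ ≤ ‖f‖},
        {φ | ‖f - ∑ q, (g.1 q).toContinuousMap.comp (φ q)‖ < 7 / 8 * ‖f‖} := by
      ext φ
      simp [O]
    rw [this]
    refine isOpen_iUnion fun g => isOpen_lt ?_ continuous_const
    refine (continuous_const.sub (continuous_finsetSum _ fun q _ => ?_)).norm
    exact (ContinuousMap.continuous_postcomp _).comp (continuous_apply q)
  have hOd : ∀ f ∈ D \ {0}, Dense (O f) := by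
    intro f hf
    rw [Metric.dense_iff]
    intro ψ ε hε
    obtain ⟨φ, h1, g, h2, h3⟩ := approx m N hN K f hf.2 ψ (ε / 2) (by positivity)
    refine ⟨φ, ?_, g, h2, h3.trans_lt ?_⟩
    · rw [Metric.mem_ball]
      refine lt_of_le_of_lt ((dist_pi_le_iff (by positivity)).2 fun q => ?_) (half_lt_self hε)
      rw [dist_eq_norm]; exact h1 q
    · have : 0 < ‖f‖ := norm_pos_iff.2 hf.2
      linarith
  obtain ⟨φ, hφ⟩ := (dense_biInter_of_isOpen hO hDc hOd).nonempty
  refine ⟨φ, surj_of_approx _ 2 (9 / 10) (by norm_num) (by norm_num) (by norm_num) fun f => ?_⟩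
  by_cases hf0 : f = 0
  · exact ⟨0, by simp [hf0]⟩
  have hf : 0 < ‖f‖ := norm_pos_iff.2 hf0
  obtain ⟨d, hdD, hd⟩ := hD.exists_dist_lt f (ε := ‖f‖ / 100) (by positivity)
  rw [dist_eq_norm] at hd
  have hd1 : ‖d‖ ≤ ‖f‖ + ‖f‖ / 100 := by
    have := norm_sub_norm_le d f
    rw [norm_sub_rev] at this
    linarith
  have hd0 : d ≠ 0 := by
    rintro rfl
    rw [sub_zero] at hd
    linarith
  obtain ⟨g, hg1, hg2⟩ := mem_iInter₂.1 hφ d ⟨hdD, hd0⟩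
  refine ⟨g, ?_, ?_⟩
  · rw [pi_norm_le_iff_of_nonneg (by positivity)]
    intro q
    have := hg1 q
    linarith
  · rw [superpos_apply]
    have := norm_add_le (f - d) (d - ∑ q, (g q).toContinuousMap.comp (φ q))
    rw [sub_add_sub_cancel] at this
    linarith

lemma compact_basic (m N : ℕ) (hN : N = 4 * (m + 1)) (K : Set (Fin m → ℝ)) (hK : IsCompact K) :
    ∃ φ : Fin N → C(Fin m → ℝ, ℝ), (∀ q x, φ q x ∈ Icc (0:ℝ) 1) ∧
      ∀ f : C(Fin m → ℝ, ℝ), ∃ g : Fin N → C(ℝ, ℝ), ∀ x ∈ K, f x = ∑ q, g q (φ q x) := by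
  have : CompactSpace K := isCompact_iff_compactSpace.1 hK
  obtain ⟨φ, hφ⟩ := compact_surj m N hN K
  have hext : ∀ q, ∃ φ' : C(Fin m → ℝ, ℝ), (∀ x, φ' x ∈ Icc (0:ℝ) 1) ∧
      ∀ x : K, φ q x = (2 * φ' x - 1) * (‖φ q‖ + 1) := by
    intro q
    have hpos : 0 < ‖φ q‖ + 1 := by positivity
    have hc : Continuous (fun x : K => (φ q x / (‖φ q‖ + 1) + 1) / 2) := by fun_prop
    obtain ⟨η, h1, h2⟩ := ContinuousMap.exists_restrict_eq_forall_mem_of_closed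
      (⟨_, hc⟩ : C(K, ℝ)) (t := Icc (0:ℝ) 1) (by
        intro x
        have h1 := abs_le.1 ((φ q).norm_coe_le_norm x)
        have h2 : -1 ≤ φ q x / (‖φ q‖ + 1) := by rw [le_div_iff₀ hpos]; linarith [h1.1]
        have h3 : φ q x / (‖φ q‖ + 1) ≤ 1 := by rw [div_le_iff₀ hpos]; linarith [h1.2]
        constructor <;> simp only [ContinuousMap.coe_mk] <;> linarith)
      ⟨0, by simp⟩ hK.isClosed
    refine ⟨η, h1, fun x => ?_⟩
    have h3 := DFunLike.congr_fun h2 x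
    simp only [ContinuousMap.restrict_apply, ContinuousMap.coe_mk] at h3
    rw [h3]
    field_simp
    ring
  choose φ' h1 h2 using hext
  refine ⟨φ', h1, fun f => ?_⟩
  obtain ⟨g, hg⟩ := hφ (f.restrict K)
  refine ⟨fun q => (g q).toContinuousMap.comp ⟨fun t => (2 * t - 1) * (‖φ q‖ + 1), by fun_prop⟩,
    fun x hx => ?_⟩
  have h3 := DFunLike.congr_fun hg ⟨x, hx⟩
  rw [superpos_apply] at h3
  simp only [ContinuousMap.sum_apply, ContinuousMap.comp_apply, ContinuousMap.restrict_apply,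
    h2] at h3
  rw [← h3]
  rfl

lemma shell_lf : LocallyFinite (fun j : ℕ => Icc (2 * j : ℝ) (2 * j + 1)) := by
  intro t
  refine ⟨Iio (t + 1), Iio_mem_nhds (by linarith), ?_⟩
  refine (finite_Iio (⌈|t| + 1⌉₊)).subset ?_
  rintro j ⟨s, hs1, hs2⟩
  simp only [mem_Iio, mem_Icc] at hs1 hs2 ⊢
  rw [Nat.lt_ceil]
  have := le_abs_self t
  have : (0:ℝ) ≤ j := by positivity
  linarith [hs2, hs1.1]

lemma glue {Y : Type*} [TopologicalSpace Y] [NormalSpace Y] (p : C(Y, ℝ)) (h : ℕ → C(Y, ℝ)) :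
    ∃ H : C(Y, ℝ), ∀ (j : ℕ) (x : Y), p x ∈ Icc (2 * j : ℝ) (2 * j + 1) → H x = h j x := by
  let D : ℕ → Set Y := fun j => p ⁻¹' Icc (2 * j : ℝ) (2 * j + 1)
  have hlf : LocallyFinite D := by
    exact shell_lf.preimage_continuous p.continuous
  have hcl : ∀ j, IsClosed (D j) := fun j => isClosed_Icc.preimage p.continuous
  have hidx : ∀ j, ∀ x ∈ D j, ⌊p x / 2⌋₊ = j := by
    rintro j x ⟨hx1, hx2⟩
    rw [Nat.floor_eq_iff (by have : (0:ℝ) ≤ j := by positivity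
                             linarith)]
    constructor <;> linarith
  have hc : ContinuousOn (fun x => h ⌊p x / 2⌋₊ x) (⋃ j, D j) := by
    refine hlf.continuousOn_iUnion hcl fun j => ?_
    exact (h j).continuous.continuousOn.congr fun x hx => by simp only [hidx j x hx]
  obtain ⟨H, hH⟩ := ContinuousMap.exists_restrict_eq (Y := ℝ) (hlf.isClosed_iUnion hcl)
    ⟨_, continuousOn_iff_continuous_domRestrict.1 hc⟩
  refine ⟨H, fun j x hx => ?_⟩
  have h3 := DFunLike.congr_fun hH ⟨x, mem_iUnion.2 ⟨j, hx⟩⟩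
  simp only [ContinuousMap.restrict_apply, ContinuousMap.coe_mk] at h3
  rw [h3]
  simp [Set.domRestrict, hidx j x hx]

lemma shells (m N : ℕ) (hN : N = 4 * (m + 1)) (p : C(Fin m → ℝ, ℝ)) (K : ℕ → Set (Fin m → ℝ))
    (hK : ∀ j, IsCompact (K j)) (hp : ∀ j : ℕ, ∀ x ∈ K j, p x ∈ Icc (2 * j : ℝ) (2 * j + 1)) :
    ∃ Ψ : Fin N → C(Fin m → ℝ, ℝ), ∀ f : C(Fin m → ℝ, ℝ), ∃ g : Fin N → C(ℝ, ℝ),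
      ∀ j, ∀ x ∈ K j, f x = ∑ q, g q (Ψ q x) := by
  choose φ hφ hb using fun j => compact_basic m N hN (K j) (hK j)
  choose Ψ hΨ using fun q => glue p (fun j => ⟨fun x => 2 * j + φ j q x, by fun_prop⟩)
  refine ⟨Ψ, fun f => ?_⟩
  choose g hg using fun j => hb j f
  choose G hG using fun q => glue (ContinuousMap.id ℝ)
    (fun j => ⟨fun t => g j q (t - 2 * j), by fun_prop⟩)
  refine ⟨G, fun j x hx => ?_⟩
  rw [hg j x hx]
  refine Finset.sum_congr rfl fun q _ => ?_
  have h1 := hΨ q j x (hp j x hx)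
  have h2 := hφ j q x
  simp only [ContinuousMap.coe_mk] at h1
  rw [hG q j (Ψ q x) (by
    rw [h1]
    constructor <;> simp only [ContinuousMap.id_apply] <;> linarith [h2.1, h2.2])]
  simp [h1]

end KolmAux

namespace KolmAux

/-- factor a function through the collapsing map -/
lemma factor (ℓ k : ℕ) (E : C(Fin ℓ → ℝ, Fin k → ℝ)) (hE : ∀ x, ‖x‖ ≤ ‖E x‖)
    (h : C(Fin ℓ → ℝ, ℝ)) (hh : ∀ x y, E x = E y → h x = h y) :
    ∃ H : C(Fin k → ℝ, ℝ), ∀ x, H (E x) = h x := by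
  have hprop : IsProperMap E := by
    rw [isProperMap_iff_tendsto_cocompact]
    refine ⟨E.continuous, ?_⟩
    rw [← Metric.cobounded_eq_cocompact, ← Metric.cobounded_eq_cocompact,
      ← tendsto_norm_atTop_iff_cobounded]
    exact tendsto_atTop_mono hE tendsto_norm_cobounded_atTop
  have hcm := hprop.isClosedMap
  have hq : IsQuotientMap (rangeFactorization E) :=
    IsClosedMap.isQuotientMap (hcm.codRestrict _) (E.continuous.rangeFactorization)
      rangeFactorization_surjective
  let H0 : range E → ℝ := fun y => h y.2.choose
  have hH0 : ∀ x, H0 (rangeFactorization E x) = h x := fun x =>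
    hh _ _ (rangeFactorization E x).2.choose_spec
  have hc : Continuous H0 := by
    rw [hq.continuous_iff]
    have : H0 ∘ rangeFactorization E = h := funext hH0
    rw [this]
    exact h.continuous
  obtain ⟨H, hH⟩ := ContinuousMap.exists_restrict_eq (Y := ℝ) hcm.isClosed_range ⟨H0, hc⟩
  refine ⟨H, fun x => ?_⟩
  rw [← hH0 x]
  exact DFunLike.congr_fun hH (rangeFactorization E x)

lemma norm_shell (t : ℝ) (ht : 0 ≤ t) :
    (∃ j : ℕ, t ∈ Icc (2 * j : ℝ) (2 * j + 1)) ∨ ∃ j : ℕ, t - 1 ∈ Icc (2 * j : ℝ) (2 * j + 1) := by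
  have h1 := Nat.floor_le ht
  have h2 := Nat.lt_floor_add_one t
  rcases Nat.even_or_odd' ⌊t⌋₊ with ⟨j, hj | hj⟩
  · left
    refine ⟨j, ?_⟩
    rw [hj] at h1 h2
    push_cast at h1 h2
    constructor <;> linarith
  · right
    refine ⟨j, ?_⟩
    rw [hj] at h1 h2
    push_cast at h1 h2
    constructor <;> linarith

lemma euclid_succ (l : ℕ) : ∃ (N N' : ℕ) (φ : Fin N ⊕ (Fin N' ⊕ Unit) → C(Fin (l + 1) → ℝ, ℝ)),
    ∀ f : C(Fin (l + 1) → ℝ, ℝ), ∃ g : Fin N ⊕ (Fin N' ⊕ Unit) → C(ℝ, ℝ),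
      ∀ x, f x = ∑ q, g q (φ q x) := by
  let nrm : C(Fin (l + 1) → ℝ, ℝ) := ⟨fun x => ‖x‖, continuous_norm⟩
  have hcpt : ∀ a b : ℝ, IsCompact {x : Fin (l + 1) → ℝ | ‖x‖ ∈ Icc a b} := by
    intro a b
    refine (isCompact_closedBall (0 : Fin (l + 1) → ℝ) b).of_isClosed_subset
      (isClosed_Icc.preimage continuous_norm) ?_
    intro x hx
    simpa using hx.2
  obtain ⟨φ₁, hφ₁⟩ := shells (l + 1) _ rfl nrm
    (fun j => {x | ‖x‖ ∈ Icc (2 * j : ℝ) (2 * j + 1)}) (fun j => hcpt _ _) (fun j x hx => hx)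
  -- collapsing map
  let D : Set ℝ := closure (⋃ j : ℕ, Icc (2 * j : ℝ) (2 * j + 1))
  let ρ : ℝ → ℝ := fun t => Metric.infDist t D
  have hρ : Continuous ρ := Metric.continuous_infDist_pt D
  have hρ0 : ∀ j : ℕ, ∀ t ∈ Icc (2 * j : ℝ) (2 * j + 1), ρ t = 0 := fun j t ht =>
    Metric.infDist_zero_of_mem (subset_closure (mem_iUnion.2 ⟨j, ht⟩))
  have hDne : D.Nonempty := ⟨0, subset_closure (mem_iUnion.2 ⟨0, by simp⟩)⟩
  let E : C(Fin (l + 1) → ℝ, Fin (l + 1 + 1) → ℝ) :=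
    ⟨fun x => Fin.cons ‖x‖ (ρ ‖x‖ • x), by
      refine continuous_pi fun i => ?_
      refine Fin.cases ?_ (fun i => ?_) i
      · simpa using continuous_norm
      · simp only [Fin.cons_succ]
        fun_prop⟩
  have hE0 : ∀ x, E x 0 = ‖x‖ := fun x => rfl
  have hEn : ∀ x, ‖x‖ ≤ ‖E x‖ := by
    intro x
    have := norm_le_pi_norm (E x) 0
    rwa [hE0, norm_norm] at this
  obtain ⟨φ₂, hφ₂⟩ := shells (l + 1 + 1) _ rfl ⟨fun y => y 0 - 1, by fun_prop⟩
    (fun j => E '' {x | ‖x‖ ∈ Icc (2 * j + 1 : ℝ) (2 * j + 1 + 1)})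
    (fun j => (hcpt _ _).image E.continuous) (by
      rintro j _ ⟨x, hx, rfl⟩
      have h1 : ‖x‖ ∈ Icc (2 * j + 1 : ℝ) (2 * j + 1 + 1) := hx
      simp only [ContinuousMap.coe_mk, hE0]
      constructor <;> linarith [h1.1, h1.2])
  refine ⟨_, _, Sum.elim φ₁ (Sum.elim (fun q => (φ₂ q).comp E) fun _ => nrm), fun f => ?_⟩
  obtain ⟨g₁, hg₁⟩ := hφ₁ f
  let h : C(Fin (l + 1) → ℝ, ℝ) := f - ∑ q, (g₁ q).comp (φ₁ q)
  have hh : ∀ x, h x = f x - ∑ q, g₁ q (φ₁ q x) := by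
    intro x; simp [h, ContinuousMap.sum_apply]
  have hh0 : ∀ j : ℕ, ∀ x, ‖x‖ ∈ Icc (2 * j : ℝ) (2 * j + 1) → h x = 0 := by
    intro j x hx
    rw [hh, hg₁ j x hx, sub_self]
  have hDiff : ∀ x y, E x = E y → h x = h y := by
    intro x y hxy
    have hn : ‖x‖ = ‖y‖ := congrFun hxy 0
    have hs : ρ ‖x‖ • x = ρ ‖y‖ • y := by
      ext i; exact congrFun hxy i.succ
    by_cases hr : ∃ j : ℕ, ‖x‖ ∈ Icc (2 * j : ℝ) (2 * j + 1)
    · obtain ⟨j, hj⟩ := hr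
      rw [hh0 j x hj, hh0 j y (hn ▸ hj)]
    · have hlf : IsClosed (⋃ j : ℕ, Icc (2 * j : ℝ) (2 * j + 1)) := by
        exact shell_lf.isClosed_iUnion fun j => isClosed_Icc
      have : ρ ‖x‖ ≠ 0 := by
        intro h0
        have := (isClosed_closure.mem_iff_infDist_zero hDne).2 h0
        rw [hlf.closure_eq] at this
        exact hr (mem_iUnion.1 this)
      rw [← hn] at hs
      rw [smul_right_injective _ this hs]
  obtain ⟨H, hH⟩ := factor _ _ E hEn h hDiff
  obtain ⟨g₂, hg₂⟩ := hφ₂ H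
  let u : C(Fin (l + 1) → ℝ, ℝ) := h - ∑ q, (g₂ q).comp ((φ₂ q).comp E)
  have hu : ∀ x, u x = h x - ∑ q, g₂ q (φ₂ q (E x)) := by
    intro x; simp [u, ContinuousMap.sum_apply]
  let e : Fin (l + 1) → ℝ := fun _ => 1
  have he : ∀ t : ℝ, 0 ≤ t → ‖t • e‖ = t := by
    intro t ht
    rw [norm_smul, Real.norm_of_nonneg ht, pi_norm_const, norm_one, mul_one]
  have hue : ∀ x, u x = u (‖x‖ • e) := by
    intro x
    have hn := he ‖x‖ (norm_nonneg x)
    rcases norm_shell ‖x‖ (norm_nonneg x) with ⟨j, hj⟩ | ⟨j, hj⟩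
    · have h1 : ∀ y, ‖y‖ = ‖x‖ → E y = Fin.cons ‖x‖ 0 := by
        intro y hy
        show (Fin.cons ‖y‖ (ρ ‖y‖ • y) : Fin (l + 1 + 1) → ℝ) = _
        rw [hy, hρ0 j _ hj, zero_smul]
      rw [hu, hu, h1 x rfl, h1 _ hn, hh0 j x hj, hh0 j _ (hn.symm ▸ hj)]
    · have h1 : ∀ y, ‖y‖ = ‖x‖ → u y = 0 := by
        intro y hy
        rw [hu, ← hH, hg₂ j (E y) (mem_image_of_mem _ ?_), sub_self]
        show ‖y‖ ∈ Icc (2 * j + 1 : ℝ) (2 * j + 1 + 1)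
        rw [hy]
        constructor <;> linarith [hj.1, hj.2]
      rw [h1 x rfl, h1 _ hn]
  refine ⟨Sum.elim g₁ (Sum.elim g₂ fun _ => ⟨fun t => u (t • e), by fun_prop⟩), fun x => ?_⟩
  have h1 := hue x
  rw [hu, hh] at h1
  simp only [Fintype.sum_sum_type, Sum.elim_inl, Sum.elim_inr, Finset.univ_unique,
    Finset.sum_singleton, ContinuousMap.coe_mk, ContinuousMap.comp_apply]
  have h2 : nrm x = ‖x‖ := rfl
  rw [h2, ← h1]
  ring

lemma euclid (l : ℕ) : ∃ (r : ℕ) (φ : Fin r → C(Fin l → ℝ, ℝ)),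
    ∀ f : C(Fin l → ℝ, ℝ), ∃ g : Fin r → C(ℝ, ℝ), ∀ x, f x = ∑ q, g q (φ q x) := by
  cases l with
  | zero =>
    refine ⟨1, fun _ => 0, fun f => ⟨fun _ => ContinuousMap.const _ (f 0), fun x => ?_⟩⟩
    simp [Subsingleton.elim x 0]
  | succ l =>
    obtain ⟨N, N', φ, h⟩ := euclid_succ l
    let e := Fintype.equivFin (Fin N ⊕ (Fin N' ⊕ Unit))
    refine ⟨_, fun q => φ (e.symm q), fun f => ?_⟩
    obtain ⟨g, hg⟩ := h f
    refine ⟨fun q => g (e.symm q), fun x => ?_⟩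
    rw [hg x]
    exact (Equiv.sum_comp e.symm (fun q => g q (φ q x))).symm

lemma closed_embedding {X : Type*} [TopologicalSpace X] [CompletelyRegularSpace X] [T2Space X]
    {r : ℕ} (e : X → Fin r → ℝ) (he : Continuous e)
    (h : ∀ f : X → ℝ, Continuous f → ∃ G : (Fin r → ℝ) → ℝ, Continuous G ∧ ∀ x, f x = G (e x)) :
    IsClosedEmbedding e := by
  have hinj : Function.Injective e := by
    intro x y hxy
    by_contra hne
    obtain ⟨f, hf, hf0, hf1⟩ := CompletelyRegularSpace.completely_regular x {y} isClosed_singleton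
      (by simpa using hne)
    obtain ⟨G, -, hG⟩ := h (fun x => f x) (by fun_prop)
    have h1 := hG x
    have h2 := hG y
    rw [hxy, ← h2, hf0, hf1 rfl] at h1
    simp at h1
  refine IsClosedEmbedding.of_continuous_injective_isClosedMap he hinj fun C hC => ?_
  refine isClosed_of_closure_subset fun y hy => ?_
  have hyr : y ∈ range e := by
    by_contra hyr
    have hne : ∀ x, dist (e x) y ≠ 0 := fun x hx => hyr ⟨x, dist_eq_zero.1 hx⟩
    obtain ⟨G, hGc, hG⟩ := h (fun x => (dist (e x) y)⁻¹)
      ((he.dist continuous_const).inv₀ hne)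
    have hcl : IsClosed {z | G z * dist z y = 1} := isClosed_eq (by fun_prop) continuous_const
    have h1 : y ∈ {z | G z * dist z y = 1} := by
      refine closure_minimal ?_ hcl hy
      rintro _ ⟨x, -, rfl⟩
      show G (e x) * dist (e x) y = 1
      rw [← hG x, inv_mul_cancel₀ (hne x)]
    have h2 : G y * dist y y = 1 := h1
    simp at h2
  obtain ⟨x, rfl⟩ := hyr
  by_contra hx
  obtain ⟨f, hf, hf0, hf1⟩ := CompletelyRegularSpace.completely_regular x C hC
    (fun hxC => hx (mem_image_of_mem _ hxC))
  obtain ⟨G, hGc, hG⟩ := h (fun x => f x) (by fun_prop)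
  have h1 : e x ∈ {z | G z = 1} := by
    refine closure_minimal ?_ (isClosed_eq hGc continuous_const) hy
    rintro _ ⟨z, hz, rfl⟩
    show G (e z) = 1
    rw [← hG z, hf1 hz]
    simp
  have h2 : G (e x) = 1 := h1
  rw [← hG x, hf0] at h2
  simp at h2

end KolmAux

/-- Characterization: for a Tychonoff (completely regular Hausdorff) space `X`,
some finite power `X^k` (`k ≥ 1`) has a finite basic family if and only if
`X` is homeomorphic to a closed subspace of some Euclidean space `ℝ^ℓ`. -/
theorem finite_basic_family_of_power_iff_closed_in_euclidean
    (X : Type*) [TopologicalSpace X] [CompletelyRegularSpace X] [T2Space X] :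
    (∃ k : ℕ, 1 ≤ k ∧
      ∃ (r : ℕ) (φ : Fin r → (Fin k → X) → ℝ),
        (∀ q, Continuous (φ q)) ∧
        ∀ f : (Fin k → X) → ℝ, Continuous f →
          ∃ g : Fin r → ℝ → ℝ,
            (∀ q, Continuous (g q)) ∧
            ∀ x : Fin k → X, f x = ∑ q : Fin r, g q (φ q x)) ↔
    (∃ (ℓ : ℕ) (s : Set (Fin ℓ → ℝ)), IsClosed s ∧ Nonempty (X ≃ₜ s)) := by
  constructor
  · rintro ⟨k, hk, r, φ, hφ, h⟩
    have hce := KolmAux.closed_embedding (X := X) (fun x q => φ q (fun _ => x))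
      (continuous_pi fun q => (hφ q).comp (by fun_prop)) (by
        intro f hf
        obtain ⟨g, hg, hfg⟩ := h (fun x => f (x ⟨0, hk⟩)) (by fun_prop)
        exact ⟨fun z => ∑ q, g q (z q), by fun_prop, fun x => hfg (fun _ => x)⟩)
    exact ⟨r, _, hce.isClosed_range, ⟨hce.isEmbedding.toHomeomorph⟩⟩
  · rintro ⟨l, s, hs, ⟨e⟩⟩
    obtain ⟨r, φ, h⟩ := KolmAux.euclid l
    refine ⟨1, le_rfl, r, fun q x => φ q (e (x 0)), fun q => by fun_prop, fun f hf => ?_⟩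
    obtain ⟨F, hF⟩ := ContinuousMap.exists_restrict_eq (Y := ℝ) hs
      ⟨fun y => f (fun _ => e.symm y), by fun_prop⟩
    obtain ⟨g, hg⟩ := h F
    refine ⟨fun q => g q, fun q => (g q).continuous, fun x => ?_⟩
    rw [← hg]
    have h3 := DFunLike.congr_fun hF (e (x 0))
    simp only [ContinuousMap.restrict_apply, ContinuousMap.coe_mk, Homeomorph.symm_apply_apply]
      at h3
    rw [h3]
    congr 1
    ext i
    rw [Subsingleton.elim i 0]
end

section
/- Every continuous function of three complex variables is a superposition of continuous functions of one complex variable together with addition: there is an r ∈ ℕ and continuous functions ψ^{pq} : ℂ → ℂ, for q = 1,…,r and p = 1,2,3, such that every continuous function f : ℂ³ → ℂ can be written f(z_1,z_2,z_3) = Σ_{q=1}^{r} g_q(ψ^{1q}(z_1) + ψ^{2q}(z_2) + ψ^{3q}(z_3)) for some continuous functions g_1,…,g_r : ℂ → ℂ. -/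
open Topology Filter Set BoundedContinuousFunction

/-- The `c`-th closed cell of the `q`-th shifted grid of mesh `1/N`. -/
def KCell (N : ℕ) (q : Fin 24) (c : ℕ) (x : unitInterval) : Prop :=
  (c : ℝ) + 1 / 48 ≤ N * (x : ℝ) + (q : ℕ) / 24 ∧
    N * (x : ℝ) + (q : ℕ) / 24 ≤ (c : ℝ) + 1 - 1 / 48

def KNear (N : ℕ) (q : Fin 24) (c : ℕ) (x : unitInterval) : Prop :=
  (c : ℝ) - 1 ≤ N * (x : ℝ) + (q : ℕ) / 24 ∧
    N * (x : ℝ) + (q : ℕ) / 24 ≤ (c : ℝ) + 2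

lemma K_approx (N : ℕ) (q : Fin 24) (φ : C(unitInterval, ℝ)) (η : ℝ) (hη : 0 < η)
    (a : ℕ → ℝ) (ha : ∀ c x, KNear N q c x → |a c - φ x| < η) :
    ∃ φ' : C(unitInterval, ℝ), ∀ x, |φ' x - φ x| < η ∧ ∀ c, KCell N q c x → φ' x = a c := by
  have key : ∃ g : C(unitInterval, ℝ), ∀ x,
      g x ∈ Metric.ball (φ x) η ∩ ⋂ c, ⋂ (_ : KCell N q c x), {a c} := by
    apply exists_continuous_forall_mem_convex_of_local_const
    · intro x
      refine (convex_ball _ _).inter (convex_iInter fun c => convex_iInter fun _ => ?_)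
      exact convex_singleton _
    · intro x0
      have hnb : ∀ᶠ x : unitInterval in 𝓝 x0,
          |(N * (x : ℝ) + (q : ℕ) / 24) - (N * (x0 : ℝ) + (q : ℕ) / 24)| < 1 / 48 := by
        have hc : Continuous (fun x : unitInterval =>
          |(N * (x : ℝ) + (q : ℕ) / 24) - (N * (x0 : ℝ) + (q : ℕ) / 24)|) := by fun_prop
        apply hc.continuousAt.eventually_lt continuousAt_const
        simp
      by_cases h : ∃ (x1 : unitInterval) (c : ℕ), |(N * (x1 : ℝ) + (q : ℕ) / 24) - (N * (x0 : ℝ) + (q : ℕ) / 24)| < 1 / 48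
          ∧ KCell N q c x1
      · obtain ⟨x1, c, h1, h2⟩ := h
        refine ⟨a c, ?_⟩
        filter_upwards [hnb] with x hx
        rw [abs_lt] at h1 hx
        obtain ⟨h3, h4⟩ := h2
        refine ⟨?_, ?_⟩
        · rw [Metric.mem_ball, Real.dist_eq]
          apply ha
          constructor <;> linarith
        · simp only [mem_iInter, mem_singleton_iff]
          rintro c' ⟨h5, h6⟩
          have e1 : (c' : ℝ) < c + 1 := by linarith
          have e2 : (c : ℝ) < c' + 1 := by linarith
          norm_cast at e1 e2
          congr 1
          omega
      · push Not at h
        refine ⟨φ x0, ?_⟩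
        have : ∀ᶠ x in 𝓝 x0, φ x ∈ Metric.ball (φ x0) η :=
          φ.continuous.continuousAt.eventually (Metric.ball_mem_nhds _ hη)
        filter_upwards [hnb, this] with x hx hx2
        refine ⟨by rwa [Metric.mem_ball, dist_comm], ?_⟩
        simp only [mem_iInter, mem_singleton_iff]
        intro c hc
        exact absurd hc (h x c hx)
  obtain ⟨g, hg⟩ := key
  refine ⟨g, fun x => ⟨?_, fun c hc => ?_⟩⟩
  · have := (hg x).1
    rwa [Metric.mem_ball, Real.dist_eq] at this
  · have := (hg x).2
    simp only [mem_iInter, mem_singleton_iff] at this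
    exact this c hc

lemma K_bad (N : ℕ) (q : Fin 24) (x : unitInterval) (h : ¬ ∃ c, KCell N q c x) :
    ∃ k : ℤ, |N * (x : ℝ) + (q : ℕ) / 24 - k| < 1 / 48 := by
  have hu : (0 : ℝ) ≤ N * (x : ℝ) + (q : ℕ) / 24 := by
    have := x.2.1
    positivity
  set u := N * (x : ℝ) + (q : ℕ) / 24 with hudef
  have h1 := Nat.floor_le hu
  have h2 := Nat.lt_floor_add_one u
  by_cases h3 : (⌊u⌋₊ : ℝ) + 1 / 48 ≤ u
  · by_cases h4 : u ≤ (⌊u⌋₊ : ℝ) + 1 - 1 / 48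
    · exact absurd ⟨_, h3, h4⟩ h
    · refine ⟨⌊u⌋₊ + 1, ?_⟩
      push_cast
      rw [abs_lt]
      constructor <;> linarith
  · refine ⟨⌊u⌋₊, ?_⟩
    push_cast
    rw [abs_lt]
    constructor <;> linarith

lemma K_bad_unique (N : ℕ) (q q' : Fin 24) (x : unitInterval) (h : ¬ ∃ c, KCell N q c x)
    (h' : ¬ ∃ c, KCell N q' c x) : q = q' := by
  obtain ⟨k, hk⟩ := K_bad N q x h
  obtain ⟨k', hk'⟩ := K_bad N q' x h'
  rw [abs_lt] at hk hk'
  have e1 : ((q : ℕ) : ℝ) - (q' : ℕ) - 24 * (k - k') < 1 := by linarith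
  have e2 : (-1 : ℝ) < ((q : ℕ) : ℝ) - (q' : ℕ) - 24 * (k - k') := by linarith
  have e1' : ((q : ℕ) : ℤ) - (q' : ℕ) - 24 * (k - k') < 1 := by exact_mod_cast e1
  have e2' : (-1 : ℤ) < ((q : ℕ) : ℤ) - (q' : ℕ) - 24 * (k - k') := by exact_mod_cast e2
  have := q.2
  have := q'.2
  ext
  omega

open Classical in
lemma K_card (N : ℕ) (x : Fin 6 → unitInterval) :
    (Finset.univ.filter (fun q : Fin 24 => ¬ ∀ j, ∃ c, KCell N q c (x j))).card ≤ 6 := by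
  have hsub : Finset.univ.filter (fun q : Fin 24 => ¬ ∀ j, ∃ c, KCell N q c (x j)) ⊆
      (Finset.univ : Finset (Fin 6)).biUnion
        (fun j => Finset.univ.filter (fun q : Fin 24 => ¬ ∃ c, KCell N q c (x j))) := by
    intro q hq
    simp only [Finset.mem_filter, Finset.mem_univ, true_and, Finset.mem_biUnion] at hq ⊢
    exact not_forall.1 hq
  refine (Finset.card_le_card hsub).trans ?_
  refine (Finset.card_biUnion_le_card_mul _ _ 1 ?_).trans (by simp)
  intro j _
  rw [Finset.card_le_one]
  intro q hq q' hq'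
  simp only [Finset.mem_filter, Finset.mem_univ, true_and] at hq hq'
  exact K_bad_unique N q q' (x j) hq hq'

/-- values with distinct sums -/
lemma K_values (N : ℕ) (q : Fin 24) (φ : Fin 6 → C(unitInterval, ℝ)) (η : ℝ) (hη : 0 < η)
    (hosc : ∀ j, ∀ x y : unitInterval, N * |(x : ℝ) - y| ≤ 3 → |φ j x - φ j y| < η / 2) :
    ∃ τ : ℝ, 0 < τ ∧ ∃ a : Fin 6 → ℕ → ℝ,
      (∀ j c x, KNear N q c x → |a j c - φ j x| < η) ∧
      ∀ c c' : Fin 6 → ℕ, (∀ j, c j < N + 4) → (∀ j, c' j < N + 4) →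
        |∑ j, a j (c j) - ∑ j, a j (c' j)| < τ → c = c' := by
  have hv : ∀ j c, ∃ v : ℝ, ∀ x, KNear N q c x → |v - φ j x| < η / 2 := by
    intro j c
    by_cases h : ∃ x, KNear N q c x
    · obtain ⟨x, hx⟩ := h
      refine ⟨φ j x, fun y hy => hosc j x y ?_⟩
      have hN : (0 : ℝ) ≤ N := by positivity
      rw [← abs_of_nonneg hN, ← abs_mul, abs_le]
      obtain ⟨h1, h2⟩ := hx
      obtain ⟨h3, h4⟩ := hy
      constructor <;> linarith
    · exact ⟨0, fun x hx => absurd ⟨x, hx⟩ h⟩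
  choose v hv using hv
  set M := N + 4 with hM
  set B : ℝ := (M : ℝ) ^ 6 with hB
  have hBpos : 0 < B := by positivity
  have hM1 : (1 : ℝ) ≤ M := by
    rw [hM]; push_cast; linarith [(Nat.cast_nonneg N : (0 : ℝ) ≤ N)]
  set τ := η / (8 * B) with hτ
  have hτpos : 0 < τ := by positivity
  have hτB : τ * B = η / 8 := by rw [hτ]; field_simp
  refine ⟨τ, hτpos, fun j c => τ * (B * ⌊v j c / (τ * B)⌋ + c * (M : ℝ) ^ (j : ℕ)), ?_, ?_⟩
  · intro j c x hx
    have hcM : c + 1 ≤ M := by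
      have h1 := hx.1
      have hx1 := x.2.2
      have hq : ((q : ℕ) : ℝ) ≤ 24 := by exact_mod_cast q.2.le
      have hN : (0 : ℝ) ≤ N := by positivity
      have : (N : ℝ) * x ≤ N := by nlinarith
      have : (c : ℝ) ≤ N + 2 := by linarith
      have : c ≤ N + 2 := by exact_mod_cast this
      omega
    have h1 := hv j c x hx
    have h2 := Int.floor_le (v j c / (τ * B))
    have h3 := Int.lt_floor_add_one (v j c / (τ * B))
    have hpos : 0 < τ * B := by positivity
    rw [le_div_iff₀ hpos] at h2
    rw [div_lt_iff₀ hpos] at h3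
    have h4 : (c : ℝ) * (M : ℝ) ^ (j : ℕ) ≤ B := by
      have e1 : (c : ℝ) ≤ M := by exact_mod_cast (by omega : c ≤ M)
      calc (c : ℝ) * (M : ℝ) ^ (j : ℕ) ≤ M * (M : ℝ) ^ (j : ℕ) := by gcongr
        _ = (M : ℝ) ^ ((j : ℕ) + 1) := by ring
        _ ≤ B := pow_le_pow_right₀ hM1 j.2
    have h5 : 0 ≤ (c : ℝ) * (M : ℝ) ^ (j : ℕ) := by positivity
    have h6 : τ * ((c : ℝ) * (M : ℝ) ^ (j : ℕ)) ≤ τ * B := by gcongr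
    have h7 : 0 ≤ τ * ((c : ℝ) * (M : ℝ) ^ (j : ℕ)) := by positivity
    rw [abs_lt] at h1 ⊢
    constructor <;> nlinarith
  · intro c c' hc hc' hlt
    set D : Fin 6 → Fin M := fun j => ⟨c j, hc j⟩ with hD
    set D' : Fin 6 → Fin M := fun j => ⟨c' j, hc' j⟩ with hD'
    have hs : ∀ (c : Fin 6 → ℕ) (hc : ∀ j, c j < M),
        ∑ j, τ * (B * ⌊v j (c j) / (τ * B)⌋ + c j * (M : ℝ) ^ (j : ℕ)) =
        τ * (((M : ℤ) ^ 6 * (∑ j, ⌊v j (c j) / (τ * B)⌋) +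
          ((finFunctionFinEquiv (fun j => (⟨c j, hc j⟩ : Fin M)) : ℕ) : ℤ) : ℤ) : ℝ) := by
      intro c hc
      rw [finFunctionFinEquiv_apply]
      push_cast
      rw [← Finset.mul_sum, Finset.sum_add_distrib, ← Finset.mul_sum]
    rw [hs c hc, hs c' hc', ← mul_sub, abs_mul, abs_of_pos hτpos] at hlt
    have hlt2 := (mul_lt_iff_lt_one_right hτpos).1 hlt
    rw [← Int.cast_sub, ← Int.cast_abs] at hlt2
    have hlt3 : |((M : ℤ) ^ 6 * (∑ j, ⌊v j (c j) / (τ * B)⌋) +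
          ((finFunctionFinEquiv D : ℕ) : ℤ)) - ((M : ℤ) ^ 6 * (∑ j, ⌊v j (c' j) / (τ * B)⌋) +
          ((finFunctionFinEquiv D' : ℕ) : ℤ))| < 1 := by exact_mod_cast hlt2
    rw [Int.abs_lt_one_iff, sub_eq_zero] at hlt3
    have hmod := congrArg (fun z : ℤ => z % ((M : ℤ) ^ 6)) hlt3
    have l1 : ((finFunctionFinEquiv D : ℕ) : ℤ) < (M : ℤ) ^ 6 := by
      exact_mod_cast (finFunctionFinEquiv D).2
    have l2 : ((finFunctionFinEquiv D' : ℕ) : ℤ) < (M : ℤ) ^ 6 := by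
      exact_mod_cast (finFunctionFinEquiv D').2
    simp only [Int.mul_add_emod_self_left] at hmod
    rw [Int.emod_eq_of_lt (by positivity) l1, Int.emod_eq_of_lt (by positivity) l2] at hmod
    have heq : finFunctionFinEquiv D = finFunctionFinEquiv D' := by
      ext; exact_mod_cast hmod
    have hDD := finFunctionFinEquiv.injective heq
    funext j
    have := congrFun hDD j
    simpa [hD, hD'] using this

open Classical in
/-- The generic set. -/
def KU (K : ℕ) : Set (Fin 24 → Fin 6 → C(unitInterval, ℝ)) :=
  {φ | ∃ G : Fin 24 → Set (Fin 6 → unitInterval),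
    (∀ x, (Finset.univ.filter (fun q : Fin 24 => x ∉ G q)).card ≤ 6) ∧
    ∃ δ : ℝ, 0 < δ ∧ ∀ q, ∀ x ∈ G q, ∀ y ∈ G q,
      |∑ j, φ q j (x j) - ∑ j, φ q j (y j)| < δ → dist x y < 1 / ((K : ℝ) + 1)}

lemma KU_open (K : ℕ) : IsOpen (KU K) := by
  rw [Metric.isOpen_iff]
  rintro φ ⟨G, hG, δ, hδ, h⟩
  refine ⟨δ / 24, by positivity, ?_⟩
  intro φ' hφ'
  refine ⟨G, hG, δ / 2, by positivity, ?_⟩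
  intro q x hx y hy hxy
  apply h q x hx y hy
  have hd : ∀ z : Fin 6 → unitInterval, |∑ j, φ q j (z j) - ∑ j, φ' q j (z j)| ≤ δ / 4 := by
    intro z
    rw [← Finset.sum_sub_distrib]
    refine (Finset.abs_sum_le_sum_abs _ _).trans ?_
    calc ∑ j, |φ q j (z j) - φ' q j (z j)| ≤ ∑ j : Fin 6, δ / 24 := by
          apply Finset.sum_le_sum
          intro j _
          rw [← Real.dist_eq]
          have h1 := ContinuousMap.dist_apply_le_dist (f := φ q j) (g := φ' q j) (z j)
          have h2 := dist_le_pi_dist (φ q) (φ' q) j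
          have h3 := dist_le_pi_dist φ φ' q
          rw [Metric.mem_ball, dist_comm] at hφ'
          linarith
      _ = δ / 4 := by simp; ring
  have h1 := abs_le.1 (hd x)
  have h2 := abs_le.1 (hd y)
  rw [abs_lt] at hxy ⊢
  constructor <;> linarith

lemma KU_dense (K : ℕ) : Dense (KU K) := by
  rw [Metric.dense_iff]
  intro φ η hη
  have huc : UniformContinuous (fun x : unitInterval => fun q j => φ q j x) :=
    CompactSpace.uniformContinuous_of_continuous (by fun_prop)
  rw [Metric.uniformContinuous_iff] at huc
  obtain ⟨δ, hδ, huc⟩ := huc (η / 2 / 2) (by positivity)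
  obtain ⟨N, hN⟩ := exists_nat_gt (max (3 / δ) (K + 1 : ℝ))
  have hN1 : 3 / δ < N := (le_max_left _ _).trans_lt hN
  have hN2 : (K + 1 : ℝ) < N := (le_max_right _ _).trans_lt hN
  have hNpos : (0 : ℝ) < N := by
    have : (0 : ℝ) ≤ K := by positivity
    linarith
  have hosc : ∀ q j, ∀ x y : unitInterval, N * |(x : ℝ) - y| ≤ 3 →
      |φ q j x - φ q j y| < η / 2 / 2 := by
    intro q j x y hxy
    have hd : dist x y < δ := by
      rw [Subtype.dist_eq, Real.dist_eq]
      rw [div_lt_iff₀ hδ] at hN1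
      by_contra hcon
      push Not at hcon
      nlinarith
    have h1 := huc hd
    have h2 := dist_le_pi_dist (fun q j => φ q j x) (fun q j => φ q j y) q
    have h3 := dist_le_pi_dist (fun j => φ q j x) (fun j => φ q j y) j
    rw [← Real.dist_eq]
    exact (h3.trans h2).trans_lt h1
  choose τ hτ a ha hinj using fun q => K_values N q (φ q) (η / 2) (by positivity) (hosc q)
  choose φ' hφ' using fun q j => K_approx N q (φ q j) (η / 2) (by positivity) (a q j) (ha q j)
  refine ⟨φ', ?_, ?_⟩
  · rw [Metric.mem_ball]
    refine lt_of_le_of_lt ?_ (by linarith : η / 2 < η)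
    refine (dist_pi_le_iff (by positivity)).2 fun q => (dist_pi_le_iff (by positivity)).2 fun j => ?_
    refine (ContinuousMap.dist_le (by positivity)).2 fun x => ?_
    rw [Real.dist_eq]
    exact (hφ' q j x).1.le
  · refine ⟨fun q => {x | ∀ j, ∃ c, KCell N q c (x j)}, fun x => by convert K_card N x; rfl,
      Finset.univ.inf' Finset.univ_nonempty τ, ?_, ?_⟩
    · rw [Finset.lt_inf'_iff]
      exact fun q _ => hτ q
    · intro q x hx y hy hxy
      choose c hc using hx
      choose c' hc' using hy
      have hlt := hxy.trans_le (Finset.inf'_le τ (Finset.mem_univ q))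
      have e1 : ∑ j, φ' q j (x j) = ∑ j, a q j (c j) :=
        Finset.sum_congr rfl fun j _ => (hφ' q j (x j)).2 _ (hc j)
      have e2 : ∑ j, φ' q j (y j) = ∑ j, a q j (c' j) :=
        Finset.sum_congr rfl fun j _ => (hφ' q j (y j)).2 _ (hc' j)
      rw [e1, e2] at hlt
      have hb : ∀ (c : ℕ) (x : unitInterval), KCell N q c x → c < N + 4 := by
        intro c x hx
        have h1 := hx.1
        have hx1 := x.2.2
        have hq : ((q : ℕ) : ℝ) ≤ 24 := by exact_mod_cast q.2.le
        have : (N : ℝ) * x ≤ N := by nlinarith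
        have : (c : ℝ) ≤ N + 2 := by linarith
        have : c ≤ N + 2 := by exact_mod_cast this
        omega
      have hcc := hinj q c c' (fun j => hb _ _ (hc j)) (fun j => hb _ _ (hc' j)) hlt
      subst hcc
      have hKpos : (0 : ℝ) < K + 1 := by positivity
      rw [dist_pi_lt_iff (by positivity)]
      intro j
      rw [Subtype.dist_eq, Real.dist_eq, lt_div_iff₀ hKpos]
      obtain ⟨h1, h2⟩ := hc j
      obtain ⟨h3, h4⟩ := hc' j
      have h5 : |(x j : ℝ) - y j| * N < 1 := by
        rw [← abs_of_pos hNpos, ← abs_mul, abs_lt]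
        constructor <;> linarith
      have := abs_nonneg ((x j : ℝ) - y j)
      nlinarith

lemma K_step (φ : Fin 24 → Fin 6 → C(unitInterval, ℝ)) (hφ : ∀ K, φ ∈ KU K)
    (f : C(Fin 6 → unitInterval, ℂ)) :
    ∃ g : Fin 24 → (ℝ →ᵇ ℂ), (∀ q, ‖g q‖ ≤ ‖f‖) ∧
      ∀ x, ‖f x - ∑ q, g q (∑ j, φ q j (x j))‖ ≤ 3 / 4 * ‖f‖ := by
  classical
  by_cases hf0 : f = 0
  · subst hf0
    exact ⟨fun _ => 0, by simp, by simp⟩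
  have hfpos : 0 < ‖f‖ := norm_pos_iff.2 hf0
  have huc : UniformContinuous f := CompactSpace.uniformContinuous_of_continuous f.continuous
  rw [Metric.uniformContinuous_iff] at huc
  obtain ⟨ρ, hρ, huc⟩ := huc (‖f‖ / 4) (by positivity)
  obtain ⟨K, hK⟩ := exists_nat_one_div_lt hρ
  obtain ⟨G, hG, δ, hδ, h⟩ := hφ K
  have key : ∀ q, ∃ g : C(ℝ, ℂ), ∀ s, g s ∈ Metric.closedBall (0 : ℂ) (‖f‖ / 24) ∩
      ⋂ y, ⋂ (_ : y ∈ G q ∧ ∑ j, φ q j (y j) = s),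
        Metric.closedBall (f y / 24) (‖f‖ / 4 / 24) := by
    intro q
    apply exists_continuous_forall_mem_convex_of_local_const
    · intro x
      refine (convex_closedBall _ _).inter (convex_iInter fun c => convex_iInter fun _ => ?_)
      exact convex_closedBall _ _
    · intro s0
      have hnb : ∀ᶠ s in 𝓝 s0, s ∈ Metric.ball s0 (δ / 2) := Metric.ball_mem_nhds _ (by positivity)
      by_cases hex : ∃ x ∈ G q, ∑ j, φ q j (x j) ∈ Metric.ball s0 (δ / 2)
      · obtain ⟨x, hx, hxs⟩ := hex
        refine ⟨f x / 24, ?_⟩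
        filter_upwards [hnb] with s hs
        refine ⟨?_, ?_⟩
        · have := f.norm_coe_le_norm x
          rw [mem_closedBall_zero_iff, norm_div]
          simp only [Complex.norm_ofNat]
          linarith
        · simp only [mem_iInter]
          rintro y ⟨hy, rfl⟩
          have hd : dist x y < ρ := by
            refine lt_trans (h q x hx y hy ?_) hK
            rw [Metric.mem_ball, Real.dist_eq, abs_lt] at hxs hs
            rw [abs_lt]
            constructor <;> linarith
          have := huc hd
          rw [mem_closedBall_iff_norm, ← sub_div, norm_div]
          simp only [Complex.norm_ofNat]
          rw [dist_eq_norm] at this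
          linarith
      · push Not at hex
        refine ⟨0, ?_⟩
        filter_upwards [hnb] with s hs
        refine ⟨by simp; positivity, ?_⟩
        simp only [mem_iInter]
        rintro y ⟨hy, rfl⟩
        exact absurd hs (hex y hy)
  choose g hg using key
  have hgb : ∀ q s, ‖g q s‖ ≤ ‖f‖ / 24 := fun q s => mem_closedBall_zero_iff.1 (hg q s).1
  refine ⟨fun q => BoundedContinuousFunction.ofNormedAddCommGroup (g q) (g q).continuous _ (hgb q),
    ?_, ?_⟩
  · intro q
    refine (BoundedContinuousFunction.norm_ofNormedAddCommGroup_le _ (by positivity) _).trans ?_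
    linarith
  · intro x
    have e : f x - ∑ q, g q (∑ j, φ q j (x j)) = ∑ q, (f x / 24 - g q (∑ j, φ q j (x j))) := by
      rw [Finset.sum_sub_distrib]
      simp
      ring
    simp only [BoundedContinuousFunction.coe_ofNormedAddCommGroup]
    rw [e]
    refine (norm_sum_le _ _).trans ?_
    calc ∑ q, ‖f x / 24 - g q (∑ j, φ q j (x j))‖
        ≤ ∑ q : Fin 24, (‖f‖ / 4 / 24 + if x ∉ G q then ‖f‖ / 12 else 0) := by
          apply Finset.sum_le_sum
          intro q _
          split_ifs with hx
          · have := (hg q (∑ j, φ q j (x j))).2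
            simp only [mem_iInter] at this
            have := this x ⟨hx, rfl⟩
            rw [mem_closedBall_iff_norm, norm_sub_rev] at this
            linarith
          · have h1 := hgb q (∑ j, φ q j (x j))
            have h2 := f.norm_coe_le_norm x
            refine (norm_sub_le _ _).trans ?_
            rw [norm_div]
            simp only [Complex.norm_ofNat]
            linarith
      _ = ‖f‖ / 4 + (Finset.univ.filter (fun q : Fin 24 => x ∉ G q)).card * (‖f‖ / 12) := by
          rw [Finset.sum_add_distrib, ← Finset.sum_filter]
          simp
          ring
      _ ≤ 3 / 4 * ‖f‖ := by
          have : ((Finset.univ.filter (fun q : Fin 24 => x ∉ G q)).card : ℝ) ≤ 6 := by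
            exact_mod_cast hG x
          nlinarith

/-- Kolmogorov superposition on the cube. -/
lemma K_main : ∃ φ : Fin 24 → Fin 6 → C(unitInterval, ℝ),
    ∀ f : C(Fin 6 → unitInterval, ℂ), ∃ g : Fin 24 → C(ℝ, ℂ),
      ∀ x, f x = ∑ q, g q (∑ j, φ q j (x j)) := by
  obtain ⟨φ, hφ⟩ := (dense_iInter_of_isOpen_nat KU_open KU_dense).nonempty
  rw [mem_iInter] at hφ
  refine ⟨φ, fun f => ?_⟩
  choose S hS1 hS2 using K_step φ hφ
  let T : (Fin 24 → (ℝ →ᵇ ℂ)) → C(Fin 6 → unitInterval, ℂ) := fun g =>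
    ⟨fun x => ∑ q, g q (∑ j, φ q j (x j)), by fun_prop⟩
  let F : ℕ → C(Fin 6 → unitInterval, ℂ) := fun m => (fun h => h - T (S h))^[m] f
  have hF0 : F 0 = f := rfl
  have hFs : ∀ m, F (m + 1) = F m - T (S (F m)) := fun m => Function.iterate_succ_apply' _ _ _
  have hFn : ∀ m, ‖F m‖ ≤ (3 / 4) ^ m * ‖f‖ := by
    intro m
    induction m with
    | zero => simp [hF0]
    | succ m ih =>
      have : ‖F (m + 1)‖ ≤ 3 / 4 * ‖F m‖ := by
        rw [hFs, ContinuousMap.norm_le _ (by positivity)]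
        exact fun x => hS2 (F m) x
      calc _ ≤ _ := this
        _ ≤ 3 / 4 * ((3 / 4) ^ m * ‖f‖) := by gcongr
        _ = _ := by ring
  have hgeo : Summable (fun m : ℕ => (3 / 4 : ℝ) ^ m * ‖f‖) :=
    (summable_geometric_of_lt_one (by norm_num) (by norm_num)).mul_right _
  have hsum : ∀ q, Summable (fun m => S (F m) q) := fun q =>
    Summable.of_norm_bounded hgeo fun m => (hS1 (F m) q).trans (hFn m)
  refine ⟨fun q => (∑' m, S (F m) q).toContinuousMap, fun x => ?_⟩
  have h1 : ∀ q s, HasSum (fun m => S (F m) q s) ((∑' m, S (F m) q) s) := by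
    intro q s
    exact (hsum q).hasSum.map (BoundedContinuousFunction.evalCLM ℂ s)
      (BoundedContinuousFunction.evalCLM ℂ s).continuous
  have h2 : HasSum (fun m => ∑ q, S (F m) q (∑ j, φ q j (x j)))
      (∑ q, (∑' m, S (F m) q) (∑ j, φ q j (x j))) :=
    hasSum_sum fun q _ => h1 q _
  have h3 := h2.tendsto_sum_nat
  have h4 : ∀ m, ∑ i ∈ Finset.range m, ∑ q, S (F i) q (∑ j, φ q j (x j)) = f x - F m x := by
    intro m
    induction m with
    | zero => simp [hF0]
    | succ m ih =>
      rw [Finset.sum_range_succ, ih, hFs]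
      simp [T]
      ring
  simp only [h4] at h3
  have h5 : Tendsto (fun m => F m x) atTop (𝓝 0) := by
    apply squeeze_zero_norm (fun m => ((F m).norm_coe_le_norm x).trans (hFn m))
    exact hgeo.tendsto_atTop_zero
  have h6 : Tendsto (fun m => f x - F m x) atTop (𝓝 (f x - 0)) := tendsto_const_nhds.sub h5
  rw [sub_zero] at h6
  exact tendsto_nhds_unique h6 h3

lemma K_sigma : ∃ σ : ℝ → unitInterval, Continuous σ ∧ Function.Injective σ :=
  ⟨unitInterval.sigmoid, by fun_prop, unitInterval.sigmoid_strictMono.injective⟩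

theorem hilbert13_complex :
    ∃ (r : ℕ) (ψ : Fin 3 → Fin r → ℂ → ℂ),
      (∀ p q, Continuous (ψ p q)) ∧
      ∀ f : ℂ × ℂ × ℂ → ℂ, Continuous f →
        ∃ g : Fin r → ℂ → ℂ,
          (∀ q, Continuous (g q)) ∧
          ∀ z₁ z₂ z₃ : ℂ,
            f (z₁, z₂, z₃) = ∑ q : Fin r, g q (ψ 0 q z₁ + ψ 1 q z₂ + ψ 2 q z₃) := by
  obtain ⟨φ, hφ⟩ := K_main
  obtain ⟨σ, hσc, hσi⟩ := K_sigma
  let A : Fin 3 → Fin 24 → ℂ → ℝ := fun p q z =>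
    φ q (![0, 2, 4] p) (σ z.re) + φ q (![1, 3, 5] p) (σ z.im)
  refine ⟨24, fun p q z => (A p q z : ℂ) + (‖z‖ : ℂ) * Complex.I, ?_, ?_⟩
  · intro p q
    fun_prop
  intro f hf
  let e : ℂ × ℂ × ℂ → (Fin 6 → unitInterval) := fun z =>
    ![σ z.1.re, σ z.1.im, σ z.2.1.re, σ z.2.1.im, σ z.2.2.re, σ z.2.2.im]
  have hec : Continuous e := by
    refine continuous_pi fun i => ?_
    fin_cases i <;> simp [e] <;> fun_prop
  have hei : Function.Injective e := by
    rintro ⟨a, b, c⟩ ⟨a', b', c'⟩ h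
    have h0 := hσi (congrFun h 0)
    have h1 := hσi (congrFun h 1)
    have h2 := hσi (congrFun h 2)
    have h3 := hσi (congrFun h 3)
    have h4 := hσi (congrFun h 4)
    have h5 := hσi (congrFun h 5)
    exact Prod.ext (Complex.ext h0 h1) (Prod.ext (Complex.ext h2 h3) (Complex.ext h4 h5))
  let nn : ℂ × ℂ × ℂ → ℝ := fun z => ‖z.1‖ + ‖z.2.1‖ + ‖z.2.2‖
  let P : Fin 24 → ℂ × ℂ × ℂ → ℝ := fun q z => A 0 q z.1 + A 1 q z.2.1 + A 2 q z.2.2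
  have hP : ∀ q z, ∑ j, φ q j (e z j) = P q z := by
    intro q z
    simp only [Fin.sum_univ_succ, P, A, e]
    simp
    ring!
  have hloc : ∀ R : ℝ, ∃ G : C(ℝ, Fin 24 → ℂ), ∀ z, nn z ≤ R → f z = ∑ q, G (P q z) q := by
    intro R
    let Kc : Set (ℂ × ℂ × ℂ) := Metric.closedBall 0 R
    have hK : IsCompact Kc := isCompact_closedBall _ _
    have : CompactSpace Kc := isCompact_iff_compactSpace.1 hK
    have hemb : IsClosedEmbedding (fun z : Kc => e z) :=
      (hec.comp continuous_subtype_val).isClosedEmbedding (hei.comp Subtype.val_injective)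
    obtain ⟨F, hF⟩ := ContinuousMap.exists_extension' hemb
      (⟨fun z : Kc => f z, by fun_prop⟩ : C(Kc, ℂ))
    obtain ⟨g, hg⟩ := hφ F
    refine ⟨⟨fun s q => g q s, by fun_prop⟩, fun z hz => ?_⟩
    have hzK : z ∈ Kc := by
      simp only [nn] at hz
      rw [mem_closedBall_zero_iff, Prod.norm_def, Prod.norm_def]
      have := norm_nonneg z.1
      have := norm_nonneg z.2.1
      have := norm_nonneg z.2.2
      refine max_le ?_ (max_le ?_ ?_) <;> linarith
    have h1 := congrFun hF ⟨z, hzK⟩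
    simp only [Function.comp, ContinuousMap.coe_mk] at h1
    rw [← h1, hg]
    simp only [hP]
    rfl
  have hsel : ∃ G : C(ℝ, C(ℝ, Fin 24 → ℂ)), ∀ t,
      G t ∈ {H : C(ℝ, Fin 24 → ℂ) | ∀ z, nn z = t → f z = ∑ q, H (P q z) q} := by
    apply exists_continuous_forall_mem_convex_of_local_const
    · intro t H hH H' hH' a b ha hb hab z hz
      have h1 := hH z hz
      have h2 := hH' z hz
      simp only [ContinuousMap.add_apply, ContinuousMap.smul_apply, Pi.add_apply, Pi.smul_apply,
        Finset.sum_add_distrib, ← Finset.smul_sum]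
      rw [← h1, ← h2, ← add_smul, hab, one_smul]
    · intro t
      obtain ⟨G, hG⟩ := hloc (t + 1)
      refine ⟨G, ?_⟩
      filter_upwards [Iio_mem_nhds (lt_add_one t)] with s hs z hz
      exact hG z (hz.le.trans (le_of_lt hs))
  obtain ⟨G, hG⟩ := hsel
  refine ⟨fun q w => G w.im w.re q, fun q => ?_, fun z₁ z₂ z₃ => ?_⟩
  · have : Continuous fun w : ℂ => G w.im w.re := by fun_prop
    exact (continuous_apply q).comp this
  · rw [hG (nn (z₁, z₂, z₃)) (z₁, z₂, z₃) rfl]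
    refine Finset.sum_congr rfl fun q _ => ?_
    simp [P, nn]
end
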